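/- Let X ⊂ int(𝔸) be an f-invariant essential annular continuum. Assume there exists ρ < 0 such that for all points x, y ∈ X̃ accessible from Ũ₊ one has k(f̃ⁿ(x), y)/n → ρ as n → ∞, and assume inf ρ_mes(f̃, X) > 0. If x ∈ X̃ is accessible from V + k, then for every integer n ≤ 0 the point f̃ⁿ(x) is accessible from (V+k)⁺, and for every integer n ≥ 0 the point f̃ⁿ(x) is accessible from (V+k)⁻. -/

import Mathlib

open Set Function MeasureTheory Filter Topology

noncomputable section

/-- The vertical fiber `[-1,1]`. -/
abbrev II : Set ℝ := Set.Icc (-1 : ℝ) 1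

/-- The universal cover `ℝ × [-1,1]` of the annulus. -/
abbrev Strip : Type := ℝ × II

/-- The compact annulus `(ℝ/ℤ) × [-1,1]`. -/
abbrev Ann : Type := AddCircle (1 : ℝ) × II

/-- The covering projection `π`. -/
def pr (z : Strip) : Ann := ((z.1 : AddCircle (1 : ℝ)), z.2)

/-- The deck transformation `T^k`. -/
def shiftPt (k : ℤ) (z : Strip) : Strip := (z.1 + k, z.2)

/-- `S + k`, the image of `S` under `T^k`. -/
def shiftSet (k : ℤ) (S : Set Strip) : Set Strip := shiftPt k '' S

/-- `f` is isotopic to the identity. -/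
def IsotopicToId (f : Ann → Ann) : Prop :=
  ∃ H : ℝ → Ann → Ann, Continuous (fun p : ℝ × Ann => H p.1 p.2) ∧
    (∀ t : ℝ, Function.Bijective (H t)) ∧ H 0 = id ∧ H 1 = f

/-- `F` is a lift of `f` commuting with the deck transformation. -/
def IsLift (f : Ann → Ann) (F : Strip → Strip) : Prop :=
  (∀ z, pr (F z) = f (pr z)) ∧ (∀ z, F (shiftPt 1 z) = shiftPt 1 (F z))

/-- `X` is an essential annular continuum with complementary components `Um`, `Up`. -/
structure IsEAC (X Um Up : Set Ann) : Prop where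
  compact : IsCompact X
  connected : IsConnected X
  inInterior : ∀ p ∈ X, ((p.2 : ℝ)) ∈ Set.Ioo (-1 : ℝ) 1
  hUm : Um = connectedComponentIn Xᶜ ((0 : AddCircle (1 : ℝ)), ⟨-1, le_rfl, by norm_num⟩)
  hUp : Up = connectedComponentIn Xᶜ ((0 : AddCircle (1 : ℝ)), ⟨1, by norm_num, le_rfl⟩)
  cover : Xᶜ = Um ∪ Up
  ne : Um ≠ Up

/-- An arc `γ : [0,1] → U ∪ {p}` with `γ([0,1)) ⊂ U` and `γ(1) = p`. -/
def IsArcTo (U : Set Strip) (γ : unitInterval → Strip) (p : Strip) : Prop :=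
  Continuous γ ∧ Function.Injective γ ∧ (∀ t, t ≠ 1 → γ t ∈ U) ∧ γ 1 = p

/-- `p` is accessible from `U`. -/
def AccFrom (U : Set Strip) (p : Strip) : Prop := ∃ γ, IsArcTo U γ p

/-- The order `≺` on accessible points, with access arcs starting on `ℝ × {b}`. -/
def PrecB (b : ℝ) (U : Set Strip) (x x' : Strip) : Prop :=
  ∃ γ γ' : unitInterval → Strip,
    IsArcTo U γ x ∧ IsArcTo U γ' x' ∧
    ((γ 0).2 : ℝ) = b ∧ ((γ' 0).2 : ℝ) = b ∧
    Disjoint (range γ) (range γ') ∧ (γ 0).1 < (γ' 0).1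

/-- `k = k(x,y)` is the unique integer with `T^k(y) ⪯ x ≺ T^{k+1}(y)`. -/
def AccIdxB (b : ℝ) (U : Set Strip) (x y : Strip) (k : ℤ) : Prop :=
  (shiftPt k y = x ∨ PrecB b U (shiftPt k y) x) ∧ PrecB b U x (shiftPt (k + 1) y)

/-- `ρ` is the prime end rotation number of the lift `F` as seen from `U`
(access arcs starting at height `b`): `k(Fⁿ(x), y)/n → ρ` for all accessible `x, y`. -/
def PrimeEndRotB (b : ℝ) (U Xt : Set Strip) (F : Strip → Strip) (ρ : ℝ) : Prop :=
  ∀ x ∈ Xt, ∀ y ∈ Xt, AccFrom U x → AccFrom U y →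
    ∀ k : ℕ → ℤ, (∀ n : ℕ, AccIdxB b U (F^[n] x) y (k n)) →
      Tendsto (fun n : ℕ => (k n : ℝ) / (n : ℝ)) atTop (𝓝 ρ)

/-- The measure-theoretic rotation set `ρ_mes(g̃, X)`, where `φ` is the displacement
function of the lift `g̃` (pushed down to the annulus). -/
def rotMes (g : Ann → Ann) (φ : Ann → ℝ) (X : Set Ann) : Set ℝ :=
  {r | ∃ μ : Measure Ann, IsProbabilityMeasure μ ∧ Measure.map g μ = μ ∧
    μ Xᶜ = 0 ∧ ∫ a, φ a ∂μ = r}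

/-- A point in the interior of the top boundary segment `(0,1) × {1}`. -/
def topSeg : Strip := ((1 : ℝ) / 2, ⟨1, by norm_num, le_rfl⟩)

/-- `β' = β ∖ {x₀} = {0} × (η, 1]`. -/
def betaP (η : ℝ) : Set Strip := {z : Strip | z.1 = 0 ∧ η < (z.2 : ℝ)}

/-- `η = max{y : (0,y) ∈ X̃}`. -/
def etaSpec (Xt : Set Strip) (η : ℝ) : Prop :=
  IsGreatest {y : ℝ | ∃ z ∈ Xt, z.1 = 0 ∧ (z.2 : ℝ) = y} η

/-- The fundamental region `V`: the closure, relative to `Ũ₊`, of the connected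
component of `Ũ₊ ∖ (β' ∪ (β' + 1))` containing the segment `(0,1) × {1}`. -/
def Vset (Utp : Set Strip) (η : ℝ) : Set Strip :=
  Utp ∩ closure (connectedComponentIn (Utp \ (betaP η ∪ shiftSet 1 (betaP η))) topSeg)

/-- A hair of `W`: an arc in `W` starting on `ℝ × {1}`. -/
def IsHair (W : Set Strip) (γ : unitInterval → Strip) : Prop :=
  Continuous γ ∧ Function.Injective γ ∧ ((γ 0).2 : ℝ) = 1 ∧ ∀ t, γ t ∈ W

/-- `(γ)₁`, the projection of the image of `γ` to the first coordinate. -/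
def proj1 (γ : unitInterval → Strip) : Set ℝ := range fun t => (γ t).1

/-- `(V + k)⁻ = ⋃_{j ≤ k} (V + j)`. -/
def VMinus (k : ℤ) (V : Set Strip) : Set Strip := ⋃ j ∈ Iic k, shiftSet j V

/-- `(V + k)⁺ = ⋃_{j ≥ k} (V + j)`. -/
def VPlus (k : ℤ) (V : Set Strip) : Set Strip := ⋃ j ∈ Ici k, shiftSet j V

/-- A crosscut of `Ũ₊`: an arc with endpoints on `X̃` and interior in `Ũ₊`. -/
def IsCrosscut (Utp Xt : Set Strip) (c : unitInterval → Strip) : Prop :=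
  Continuous c ∧ Function.Injective c ∧ c 0 ∈ Xt ∧ c 1 ∈ Xt ∧
    ∀ t, t ≠ 0 → t ≠ 1 → c t ∈ Utp

/-- `F^n` for `n : ℤ`. -/
def iterZ (F : Strip ≃ₜ Strip) (n : ℤ) : Strip → Strip := fun z => (F.toEquiv ^ n) z

end

/-- Planar coordinate of a point of the strip. -/
noncomputable def ct (z : Strip) : ℂ := ⟨z.1, (z.2 : ℝ)⟩

@[simp] lemma ct_re (z : Strip) : (ct z).re = z.1 := rfl
@[simp] lemma ct_im (z : Strip) : (ct z).im = (z.2 : ℝ) := rfl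

lemma ct_eq (z : Strip) : ct z = (z.1 : ℂ) + ((z.2 : ℝ) : ℂ) * Complex.I := by
  apply Complex.ext <;> simp

lemma continuous_ct : Continuous ct := by
  have : ct = fun z : Strip => (z.1 : ℂ) + ((z.2 : ℝ) : ℂ) * Complex.I := funext ct_eq
  rw [this]; fun_prop

lemma ct_inj {z w : Strip} (h : ct z = ct w) : z = w := by
  have h1 := congrArg Complex.re h
  have h2 := congrArg Complex.im h
  simp only [ct_re, ct_im] at h1 h2
  exact Prod.ext h1 (Subtype.ext h2)

/-- Retraction of the plane onto the strip. -/
noncomputable def cl (p : ℝ × ℝ) : Strip := (p.1, Set.projIcc (-1 : ℝ) 1 (by norm_num) p.2)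

lemma continuous_cl : Continuous cl := by
  unfold cl
  exact continuous_fst.prodMk (continuous_projIcc.comp continuous_snd)

/-- Inclusion of the strip in the plane. -/
def emb (z : Strip) : ℝ × ℝ := (z.1, (z.2 : ℝ))

lemma continuous_emb : Continuous emb := by
  unfold emb; fun_prop

lemma cl_emb (z : Strip) : cl (emb z) = z := by
  unfold cl emb
  exact Prod.ext rfl (Set.projIcc_val (by norm_num) z.2)

instance : LocallyPathConnectedSpace Strip :=
  Topology.IsQuotientMap.locallyPathConnectedSpace (f := cl)
    (Topology.IsQuotientMap.of_inverse continuous_emb continuous_cl cl_emb)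

lemma continuous_pr : Continuous pr := by
  unfold pr
  exact ((AddCircle.continuous_mk' (1 : ℝ)).comp continuous_fst).prodMk continuous_snd

lemma isOpenMap_pr : IsOpenMap pr := by
  have : pr = Prod.map (fun x : ℝ => (x : AddCircle (1 : ℝ))) id := rfl
  rw [this]
  exact (QuotientAddGroup.isOpenMap_coe).prodMap IsOpenMap.id

lemma pr_surj : Function.Surjective pr := by
  rintro ⟨a, b⟩
  obtain ⟨x, rfl⟩ := QuotientAddGroup.mk_surjective a
  exact ⟨(x, b), rfl⟩

instance : LocallyPathConnectedSpace Ann :=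
  Topology.IsQuotientMap.locallyPathConnectedSpace (f := pr)
    (isOpenMap_pr.isQuotientMap continuous_pr pr_surj)

@[simp] lemma shiftPt_fst (k : ℤ) (z : Strip) : (shiftPt k z).1 = z.1 + k := rfl
@[simp] lemma shiftPt_snd (k : ℤ) (z : Strip) : (shiftPt k z).2 = z.2 := rfl

@[simp] lemma pr_shift (k : ℤ) (z : Strip) : pr (shiftPt k z) = pr z := by
  unfold pr shiftPt
  refine Prod.ext ?_ rfl
  simp only [AddCircle.coe_add]
  have : ((k : ℝ) : AddCircle (1 : ℝ)) = 0 := by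
    rw [AddCircle.coe_eq_zero_iff]; exact ⟨k, by simp⟩
  rw [this, add_zero]

lemma shiftPt_shiftPt (k l : ℤ) (z : Strip) : shiftPt k (shiftPt l z) = shiftPt (k + l) z := by
  unfold shiftPt
  refine Prod.ext ?_ rfl
  simp only; push_cast; ring

@[simp] lemma shiftPt_zero (z : Strip) : shiftPt 0 z = z := by
  unfold shiftPt; simp

lemma continuous_shiftPt (k : ℤ) : Continuous (shiftPt k) := by
  unfold shiftPt; fun_prop

lemma shiftPt_inj (k : ℤ) : Function.Injective (shiftPt k) := by
  intro a b h
  have := congrArg (shiftPt (-k)) h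
  simpa [shiftPt_shiftPt] using this

lemma pr_eq_pr {z w : Strip} (h : pr z = pr w) : ∃ k : ℤ, z = shiftPt k w := by
  unfold pr at h
  have h1 := congrArg Prod.fst h
  have h2 := congrArg Prod.snd h
  simp only at h1 h2
  have h3 : ((z.1 - w.1 : ℝ) : AddCircle (1 : ℝ)) = 0 := by
    rw [AddCircle.coe_sub, h1, sub_self]
  rw [AddCircle.coe_eq_zero_iff] at h3
  obtain ⟨k, hk⟩ := h3
  refine ⟨k, Prod.ext ?_ h2⟩
  simp at hk ⊢; linarith

lemma mem_shiftSet {k : ℤ} {S : Set Strip} {z : Strip} :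
    z ∈ shiftSet k S ↔ shiftPt (-k) z ∈ S := by
  constructor
  · rintro ⟨w, hw, rfl⟩
    simpa [shiftPt_shiftPt] using hw
  · intro h
    exact ⟨_, h, by simp [shiftPt_shiftPt]⟩

/-- Existence of continuous logarithms on retracts of the plane. -/
lemma exists_log {A : Type*} [TopologicalSpace A] (r : ℝ × ℝ → A) (i : A → ℝ × ℝ)
    (hr : Continuous r) (hi : Continuous i) (hri : ∀ a, r (i a) = a)
    (h : A → ℂ) (hc : Continuous h) (h0 : ∀ a, h a ≠ 0) (a₀ : A) (e₀ : ℂ)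
    (he : Complex.exp e₀ = h a₀) :
    ∃ L : A → ℂ, Continuous L ∧ (∀ a, Complex.exp (L a) = h a) ∧ L a₀ = e₀ := by
  obtain ⟨L, ⟨hL0, hL⟩, -⟩ := Complex.isCoveringMapOn_exp.existsUnique_continuousMap_lifts
    (⟨h ∘ r, hc.comp hr⟩ : C(ℝ × ℝ, ℂ)) (a₀ := i a₀) (e₀ := e₀) (by simp [hri, he])
    (fun a => by simp [h0])
  refine ⟨fun a => L (i a), (map_continuous L).comp hi, fun a => ?_, hL0⟩
  have := congrFun hL (i a)
  simpa [hri] using this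

lemma exists_log_strip (h : Strip → ℂ) (hc : Continuous h) (h0 : ∀ a, h a ≠ 0) (a₀ : Strip)
    (e₀ : ℂ) (he : Complex.exp e₀ = h a₀) :
    ∃ L : Strip → ℂ, Continuous L ∧ (∀ a, Complex.exp (L a) = h a) ∧ L a₀ = e₀ :=
  exists_log cl emb continuous_cl continuous_emb cl_emb h hc h0 a₀ e₀ he

lemma exists_log_plane (h : ℝ × ℝ → ℂ) (hc : Continuous h) (h0 : ∀ a, h a ≠ 0) (a₀ : ℝ × ℝ)
    (e₀ : ℂ) (he : Complex.exp e₀ = h a₀) :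
    ∃ L : ℝ × ℝ → ℂ, Continuous L ∧ (∀ a, Complex.exp (L a) = h a) ∧ L a₀ = e₀ :=
  exists_log id id continuous_id continuous_id (fun _ => rfl) h hc h0 a₀ e₀ he

lemma exists_log_I (h : unitInterval → ℂ) (hc : Continuous h) (h0 : ∀ a, h a ≠ 0)
    (a₀ : unitInterval) (e₀ : ℂ) (he : Complex.exp e₀ = h a₀) :
    ∃ L : unitInterval → ℂ, Continuous L ∧ (∀ a, Complex.exp (L a) = h a) ∧ L a₀ = e₀ :=
  exists_log (fun p => Set.projIcc (0 : ℝ) 1 zero_le_one p.1) (fun t => ((t : ℝ), 0))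
    (continuous_projIcc.comp continuous_fst) (by fun_prop) (fun a => Set.projIcc_val zero_le_one _)
    h hc h0 a₀ e₀ he

lemma exists_log_II (h : unitInterval × unitInterval → ℂ) (hc : Continuous h)
    (h0 : ∀ a, h a ≠ 0)
    (a₀ : unitInterval × unitInterval) (e₀ : ℂ) (he : Complex.exp e₀ = h a₀) :
    ∃ L : unitInterval × unitInterval → ℂ, Continuous L ∧ (∀ a, Complex.exp (L a) = h a) ∧
      L a₀ = e₀ :=
  exists_log (fun p => (Set.projIcc (0 : ℝ) 1 zero_le_one p.1,
      Set.projIcc (0 : ℝ) 1 zero_le_one p.2)) (fun t => ((t.1 : ℝ), (t.2 : ℝ)))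
    ((continuous_projIcc.comp continuous_fst).prodMk (continuous_projIcc.comp continuous_snd))
    (by fun_prop) (fun a => Prod.ext (Set.projIcc_val zero_le_one _) (Set.projIcc_val zero_le_one _))
    h hc h0 a₀ e₀ he

/-- Uniqueness of continuous logarithms. -/
lemma log_unique {A : Type*} [TopologicalSpace A] [PreconnectedSpace A] (L M : A → ℂ)
    (hL : Continuous L) (hM : Continuous M) (h : ∀ a, Complex.exp (L a) = Complex.exp (M a))
    (a₀ : A) (h0 : L a₀ = M a₀) : L = M := by
  refine Complex.isCoveringMap_exp.eq_of_comp_eq hL hM ?_ a₀ h0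
  funext a
  exact Subtype.ext (h a)

/-- On a preconnected set, two logs of the same function differ by a constant. -/
lemma log_diff_const {A : Type*} [TopologicalSpace A] [PreconnectedSpace A] (L M : A → ℂ)
    (hL : Continuous L) (hM : Continuous M) (h : ∀ a, Complex.exp (L a) = Complex.exp (M a))
    (a b : A) : L a - M a = L b - M b := by
  have := log_unique L (fun x => M x + (L b - M b)) hL (by fun_prop) (fun x => by
    rw [Complex.exp_add, Complex.exp_sub, h b, div_self (Complex.exp_ne_zero _), mul_one, h x])
    b (by ring)
  have h2 : L a = M a + (L b - M b) := congrFun this a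
  rw [h2]; ring

/-- The principal logarithm is continuous on the closed upper half plane minus zero. -/
lemma continuousOn_log_upper : ContinuousOn Complex.log {w : ℂ | 0 ≤ w.im ∧ w ≠ 0} := by
  rintro w ⟨hw, hw0⟩
  by_cases hs : w ∈ Complex.slitPlane
  · exact (continuousAt_clog hs).continuousWithinAt
  · have h1 : w.re ≤ 0 ∧ w.im = 0 := by
      simpa [Complex.mem_slitPlane_iff, not_or] using hs
    have h2 : w.re < 0 := lt_of_le_of_ne h1.1 (fun h => hw0 (Complex.ext h h1.2))
    exact (Complex.continuousWithinAt_log_of_re_neg_of_im_zero h2 h1.2).mono (fun v hv => hv.1)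

lemma continuous_log_upper {A : Type*} [TopologicalSpace A] (h : A → ℂ) (hc : Continuous h)
    (h1 : ∀ a, 0 ≤ (h a).im) (h0 : ∀ a, h a ≠ 0) : Continuous fun a => Complex.log (h a) :=
  continuousOn_log_upper.comp_continuous hc (fun a => ⟨h1 a, h0 a⟩)

/-- A point on the top, minus a point of the strip, is in the closed upper half plane. -/
lemma top_sub_im {p z : Strip} (hp : (p.2 : ℝ) = 1) : 0 ≤ (ct p - ct z).im := by
  have := z.2.2.2
  simp [hp]; exact this

lemma ct_sub_ne {p z : Strip} (h : p ≠ z) : ct p - ct z ≠ 0 :=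
  fun h' => h (ct_inj (sub_eq_zero.mp h'))

/-- log of the negative of a positive-real-direction number. -/
lemma log_neg_of_im_pos {w : ℂ} (hw : 0 < w.im) :
    Complex.log w = Complex.log (-w) + Real.pi * Complex.I := by
  rw [Complex.log, Complex.log, norm_neg, Complex.arg_neg_eq_arg_sub_pi_of_im_pos hw]
  push_cast; ring

lemma log_neg_of_re {w : ℂ} (hw : w.re < 0) (hi : w.im = 0) :
    Complex.log w = Complex.log (-w) + Real.pi * Complex.I := by
  rw [Complex.log, Complex.log, norm_neg]
  have h1 : Complex.arg w = Real.pi := Complex.arg_eq_pi_iff.mpr ⟨hw, hi⟩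
  have h2 : Complex.arg (-w) = 0 := Complex.arg_eq_zero_iff.mpr ⟨by simp; linarith, by simp [hi]⟩
  rw [h1, h2]; push_cast; ring

lemma exp_pi_add (w : ℂ) : Complex.exp (w + Real.pi * Complex.I) = - Complex.exp w := by
  rw [Complex.exp_add, Complex.exp_pi_mul_I]; ring

lemma exp_sub_pi (w : ℂ) : Complex.exp (w - Real.pi * Complex.I) = - Complex.exp w := by
  rw [Complex.exp_sub, Complex.exp_pi_mul_I]; field_simp

instance : PreconnectedSpace II := Subtype.preconnectedSpace isPreconnected_Icc

/-- top point -/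
def tp (x : ℝ) : Strip := (x, ⟨1, by norm_num, le_rfl⟩)
/-- bottom point -/
def bp (x : ℝ) : Strip := (x, ⟨-1, le_rfl, by norm_num⟩)

lemma continuous_tp : Continuous tp := by unfold tp; fun_prop
lemma continuous_bp : Continuous bp := by unfold bp; fun_prop

lemma eq_tp {z : Strip} (h : (z.2 : ℝ) = 1) : z = tp z.1 := Prod.ext rfl (Subtype.ext h)

@[simp] lemma tp_fst (x : ℝ) : (tp x).1 = x := rfl
@[simp] lemma tp_snd (x : ℝ) : ((tp x).2 : ℝ) = 1 := rfl


lemma isOpen_Xc {X Um Up : Set Ann} (hX : IsEAC X Um Up) : IsOpen Xᶜ := hX.compact.isClosed.isOpen_compl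

lemma isOpen_Up {X Um Up : Set Ann} (hX : IsEAC X Um Up) : IsOpen Up := by
  rw [hX.hUp]; exact (isOpen_Xc hX).connectedComponentIn

lemma isOpen_Um {X Um Up : Set Ann} (hX : IsEAC X Um Up) : IsOpen Um := by
  rw [hX.hUm]; exact (isOpen_Xc hX).connectedComponentIn

lemma disj_UmUp {X Um Up : Set Ann} (hX : IsEAC X Um Up) : Disjoint Um Up := by
  have h := hX.ne
  rw [hX.hUm, hX.hUp] at h ⊢
  by_contra hd
  rw [Set.not_disjoint_iff] at hd
  obtain ⟨a, h1, h2⟩ := hd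
  exact h ((connectedComponentIn_eq h1).trans (connectedComponentIn_eq h2).symm)

lemma Up_sub {X Um Up : Set Ann} (hX : IsEAC X Um Up) : Up ⊆ Xᶜ := by rw [hX.cover]; exact subset_union_right
lemma Um_sub {X Um Up : Set Ann} (hX : IsEAC X Um Up) : Um ⊆ Xᶜ := by rw [hX.cover]; exact subset_union_left

lemma tp_mem {X Um Up : Set Ann} (hX : IsEAC X Um Up) (x : ℝ) : pr (tp x) ∈ Up := by
  have h1 : IsPreconnected (range fun x => pr (tp x)) :=
    isPreconnected_range (continuous_pr.comp continuous_tp)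
  have h2 : (range fun x => pr (tp x)) ⊆ Xᶜ := by
    rintro _ ⟨x, rfl⟩ hx
    have := (hX.inInterior _ hx).2
    simp [pr, tp] at this
  rw [hX.hUp]
  exact h1.subset_connectedComponentIn ⟨0, rfl⟩ h2 ⟨x, rfl⟩

lemma bp_mem {X Um Up : Set Ann} (hX : IsEAC X Um Up) (x : ℝ) : pr (bp x) ∈ Um := by
  have h1 : IsPreconnected (range fun x => pr (bp x)) :=
    isPreconnected_range (continuous_pr.comp continuous_bp)
  have h2 : (range fun x => pr (bp x)) ⊆ Xᶜ := by
    rintro _ ⟨x, rfl⟩ hx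
    have := (hX.inInterior _ hx).1
    simp [pr, bp] at this
  rw [hX.hUm]
  exact h1.subset_connectedComponentIn ⟨0, rfl⟩ h2 ⟨x, rfl⟩

lemma bp_nmem {X Um Up : Set Ann} (hX : IsEAC X Um Up) (x : ℝ) : pr (bp x) ∉ Up := fun h =>
  (Set.disjoint_left.mp (disj_UmUp hX)) (bp_mem hX x) h

open Classical in
lemma glue_cont {X Um Up : Set Ann} (hX : IsEAC X Um Up) {Y : Type*} [TopologicalSpace Y] (k : Y → Strip) (hk : Continuous k)
    (a b : Y → ℂ) (ha : Continuous a) (hb : Continuous b)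
    (hab : ∀ y, pr (k y) ∈ X → a y = b y) :
    Continuous fun y => if pr (k y) ∈ Up then a y else b y := by
  refine ha.if ?_ hb
  intro y hy
  apply hab
  by_contra hn
  have ho : IsOpen {y | pr (k y) ∈ Up} := (isOpen_Up hX).preimage (continuous_pr.comp hk)
  have ho' : IsOpen {y | pr (k y) ∈ Um} := (isOpen_Um hX).preimage (continuous_pr.comp hk)
  have h1 : y ∉ {y | pr (k y) ∈ Up} := by
    rw [ho.frontier_eq] at hy; exact hy.2
  have h2 : pr (k y) ∈ Um := by
    have h3 : pr (k y) ∈ Xᶜ := hn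
    rw [hX.cover] at h3
    exact h3.resolve_right h1
  have h3 : y ∈ closure {y | pr (k y) ∈ Up} := frontier_subset_closure hy
  rw [mem_closure_iff] at h3
  obtain ⟨w, hw1, hw2⟩ := h3 _ ho' h2
  exact (Set.disjoint_left.mp (disj_UmUp hX)) hw1 hw2

/-- `X̃` has no decomposition in a left part and a right part. -/
lemma no_split {X Um Up : Set Ann} (hX : IsEAC X Um Up) (E G : Set Strip) (hE : IsClosed E) (hG : IsClosed G) (hEG : Disjoint E G)
    (hcov : ∀ z, pr z ∈ X → z ∈ E ∨ z ∈ G) (M : ℝ)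
    (hEM : ∀ z ∈ E, z.1 ≤ M) (hGM : ∀ z ∈ G, -M ≤ z.1) : False := by
  classical
  obtain ⟨u, hu0, hu1, -⟩ := exists_continuous_zero_one_of_isClosed hE hG hEG
  have huc : Continuous u := map_continuous u
  have h2 : Complex.exp (2 * Real.pi * Complex.I) = 1 := Complex.exp_two_pi_mul_I
  set c : ℂ := 2 * Real.pi * Complex.I with hc
  have hc0 : c ≠ 0 := Complex.two_pi_I_ne_zero
  set h : Strip → ℂ := fun z => if pr z ∈ Up then Complex.exp (c * u z) else 1 with hh
  have hcont : Continuous h := by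
    refine glue_cont hX id continuous_id (fun z => Complex.exp (c * u z)) (fun _ => 1)
      (by fun_prop) continuous_const ?_
    intro y hy
    rcases hcov y hy with h' | h'
    · have := hu0 h'; simp at this; simp [this]
    · have := hu1 h'; simp at this; simp [this, h2]
  have hne : ∀ z, h z ≠ 0 := by
    intro z; simp only [hh]; split_ifs
    · exact Complex.exp_ne_zero _
    · exact one_ne_zero
  obtain ⟨L, hL, hLe, -⟩ := exists_log_strip h hcont hne (tp 0) _ (Complex.exp_log (hne _))
  have e1 := log_diff_const (fun x : ℝ => L (bp x)) (fun _ => 0)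
    (hL.comp continuous_bp) continuous_const
    (fun x => by rw [hLe]; simp [hh, bp_nmem hX]) (M+1) (-(M+1))
  have e2 := log_diff_const (fun x : ℝ => L (tp x)) (fun x => c * u (tp x))
    (hL.comp continuous_tp) (by have := continuous_tp; fun_prop)
    (fun x => by rw [hLe]; simp [hh, tp_mem hX]) (M+1) (-(M+1))
  have key : ∀ (x : ℝ) (d : ℂ), Complex.exp (c * d) = 1 →
      (∀ y : II, pr (x, y) ∈ X → (u (x, y) : ℂ) = d) →
      L (tp x) - c * (u (tp x) - d) = L (bp x) := by
    intro x d hd hy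
    have hk : Continuous fun y : II => ((x, y) : Strip) := by fun_prop
    have e := log_diff_const (fun y : II => L (x, y))
      (fun y : II => if pr (x, y) ∈ Up then c * (u (x, y) - d) else 0) (hL.comp hk)
      (glue_cont hX (fun y : II => ((x, y) : Strip)) hk (fun y => c * (u (x, y) - d)) (fun _ => 0)
        (by fun_prop) continuous_const (fun y hy' => by rw [hy y hy']; ring))
      (fun y => by
        rw [hLe]; simp only [hh]; split_ifs
        · rw [mul_sub, Complex.exp_sub, hd, div_one]
        · simp) ⟨1, by norm_num, le_rfl⟩ ⟨-1, le_rfl, by norm_num⟩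
    have ht := tp_mem hX x
    have hb := bp_nmem hX x
    unfold tp at ht ⊢
    unfold bp at hb ⊢
    rw [if_pos ht, if_neg hb, sub_zero] at e
    exact e
  have e3 := key (M+1) 1 (by simpa using h2) (fun y hy => by
    rcases hcov _ hy with h' | h'
    · have := hEM _ h'; simp at this; linarith
    · have := hu1 h'; simp at this; simp [this])
  have e4 := key (-(M+1)) 0 (by simp) (fun y hy => by
    rcases hcov _ hy with h' | h'
    · have := hu0 h'; simp at this; simp [this]
    · have := hGM _ h'; simp at this; linarith)
  apply hc0
  linear_combination e1 - e2 + e3 - e4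

/-- bounded clopen subsets of `X̃` are empty. -/
lemma null_clop {X Um Up : Set Ann} (hX : IsEAC X Um Up) (K O : Set Strip) (hO : IsOpen O) (hKO : K = O ∩ pr ⁻¹' X) (hK : IsClosed K)
    (M : ℝ) (hM : ∀ z ∈ K, |z.1| ≤ M) : K = ∅ := by
  by_contra hne
  obtain ⟨z₀, hz₀⟩ := Set.nonempty_iff_ne_empty.mpr hne
  have hKc : IsCompact K := by
    refine ((isCompact_Icc (a := -M) (b := M)).prod isCompact_univ).of_isClosed_subset hK ?_
    intro z hz
    exact ⟨abs_le.mp (hM z hz), mem_univ _⟩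
  have hpc : IsClosed (pr '' K) := (hKc.image continuous_pr).isClosed
  have hall : X ⊆ pr '' K := by
    intro a ha
    by_contra hna
    obtain ⟨b, hb, ⟨o, ho, rfl⟩, hb2⟩ := hX.connected.isPreconnected (pr '' O) (pr '' K)ᶜ
      (isOpenMap_pr _ hO) hpc.isOpen_compl (fun b hb => by
        by_cases h : b ∈ pr '' K
        · left; obtain ⟨w, hw, rfl⟩ := h; rw [hKO] at hw; exact ⟨w, hw.1, rfl⟩
        · right; exact h)
      ⟨pr z₀, by rw [hKO] at hz₀; exact hz₀.2, ⟨z₀, by rw [hKO] at hz₀; exact hz₀.1, rfl⟩⟩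
      ⟨a, ha, hna⟩
    exact hb2 ⟨o, by rw [hKO]; exact ⟨ho, hb⟩, rfl⟩
  have hKX : ∀ z ∈ K, pr z ∈ X := fun z hz => by rw [hKO] at hz; exact hz.2
  have hXc : IsClosed (pr ⁻¹' X) := hX.compact.isClosed.preimage continuous_pr
  refine no_split hX (⋃ j : ℕ, (shiftPt (j : ℤ)) ⁻¹' K)
    (pr ⁻¹' X ∩ ⋂ j : ℕ, ((shiftPt (j : ℤ)) ⁻¹' O)ᶜ) ?_ ?_ ?_ ?_ M ?_ ?_
  · refine LocallyFinite.isClosed_iUnion ?_ (fun j => hK.preimage (continuous_shiftPt _))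
    intro z
    refine ⟨{w | z.1 - 1 < w.1}, (isOpen_lt continuous_const continuous_fst).mem_nhds (by simp), ?_⟩
    refine (Set.finite_Iic (Nat.ceil (M - z.1 + 1))).subset ?_
    rintro j ⟨w, hw1, hw2⟩
    have := hM _ hw1
    have h3 := (abs_le.mp this).2
    simp at h3 hw2
    have : (j : ℝ) ≤ Nat.ceil (M - z.1 + 1) := le_trans (by linarith) (Nat.le_ceil _)
    exact_mod_cast this
  · exact hXc.inter (isClosed_iInter fun j => (hO.preimage (continuous_shiftPt _)).isClosed_compl)
  · rw [Set.disjoint_left]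
    rintro z hz ⟨-, hz2⟩
    obtain ⟨j, hj⟩ := mem_iUnion.mp hz
    have := mem_iInter.mp hz2 j
    apply this
    rw [mem_preimage, hKO] at hj
    exact hj.1
  · intro z hz
    by_cases h : ∃ j : ℕ, shiftPt (j : ℤ) z ∈ O
    · obtain ⟨j, hj⟩ := h
      left; refine mem_iUnion.mpr ⟨j, ?_⟩
      rw [mem_preimage, hKO]; exact ⟨hj, by simpa using hz⟩
    · right; refine ⟨hz, mem_iInter.mpr fun j hj => h ⟨j, hj⟩⟩
  · intro z hz
    obtain ⟨j, hj⟩ := mem_iUnion.mp hz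
    have := (abs_le.mp (hM _ hj)).2
    simp at this
    have : (0 : ℝ) ≤ j := by positivity
    linarith
  · rintro z ⟨hz, hz2⟩
    obtain ⟨w, hw, hwz⟩ := hall hz
    obtain ⟨i, rfl⟩ := pr_eq_pr hwz
    have h3 := (abs_le.mp (hM _ hw)).1
    simp at h3
    by_cases hi : 0 ≤ i
    · exfalso
      obtain ⟨j, rfl⟩ := Int.eq_ofNat_of_zero_le hi
      have := mem_iInter.mp hz2 j
      apply this
      rw [hKO] at hw
      exact hw.1
    · have : (i : ℝ) ≤ 0 := by push Not at hi; exact_mod_cast hi.le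
      linarith

lemma X_lt_one {X Um Up : Set Ann} (hX : IsEAC X Um Up) {z : Strip} (hz : pr z ∈ X) : (z.2 : ℝ) < 1 := (hX.inInterior _ hz).2

lemma U_ne_X {X Um Up : Set Ann} (hX : IsEAC X Um Up) {p z : Strip} (hp : pr p ∈ Up) (hz : pr z ∈ X) : p ≠ z := by
  rintro rfl; exact Up_sub hX hp hz

lemma top_sub_im_pos {X Um Up : Set Ann} (hX : IsEAC X Um Up) {p z : Strip} (hp : (p.2 : ℝ) = 1) (hz : pr z ∈ X) :
    0 < (ct p - ct z).im := by
  have := X_lt_one hX hz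
  simp [hp]; exact this

/-- `L` is the normalized logarithm of `σ - z`. -/
def IsLg (σ : unitInterval → Strip) (z : Strip) (L : unitInterval → ℂ) : Prop :=
  Continuous L ∧ (∀ t, Complex.exp (L t) = ct (σ t) - ct z) ∧ L 0 = Complex.log (ct (σ 0) - ct z)

lemma exists_isLg (σ : unitInterval → Strip) (hσ : Continuous σ) (z : Strip)
    (hz : ∀ t, σ t ≠ z) : ∃ L, IsLg σ z L := by
  have hc : Continuous fun t => ct (σ t) - ct z := (continuous_ct.comp hσ).sub continuous_const
  obtain ⟨L, h1, h2, h3⟩ := exists_log_I (fun t => ct (σ t) - ct z) hc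
    (fun t => ct_sub_ne (hz t)) 0 (Complex.log (ct (σ 0) - ct z))
    (Complex.exp_log (ct_sub_ne (hz 0)))
  exact ⟨L, h1, h2, h3⟩

lemma isLg_unique {σ : unitInterval → Strip} {z : Strip} {L L' : unitInterval → ℂ}
    (h : IsLg σ z L) (h' : IsLg σ z L') : L = L' :=
  log_unique L L' h.1 h'.1 (fun t => by rw [h.2.1, h'.2.1]) 0 (by rw [h.2.2, h'.2.2])

lemma log_mul_upper {w w' : ℂ} (hw : 0 < w.im) (hw' : 0 < w'.im) (hq : 0 < (w' / w).re) :
    Complex.log w' = Complex.log w + Complex.log (w' / w) := by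
  have h0 : w ≠ 0 := fun h => by rw [h] at hw; simp at hw
  have h0' : w' ≠ 0 := fun h => by rw [h] at hw'; simp at hw'
  have he : Complex.exp (Complex.log w') = Complex.exp (Complex.log w + Complex.log (w' / w)) := by
    rw [Complex.exp_add, Complex.exp_log h0, Complex.exp_log h0',
      Complex.exp_log (div_ne_zero h0' h0)]
    field_simp
  rw [Complex.exp_eq_exp_iff_exists_int] at he
  obtain ⟨n, hn⟩ := he
  have him := congrArg Complex.im hn
  simp only [Complex.add_im, Complex.log_im, Complex.mul_im, Complex.mul_re] at him
  simp at him
  have a1 : 0 ≤ Complex.arg w := Complex.arg_nonneg_iff.mpr hw.le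
  have a2 := Complex.arg_le_pi w
  have a3 : 0 ≤ Complex.arg w' := Complex.arg_nonneg_iff.mpr hw'.le
  have a4 := Complex.arg_le_pi w'
  have a5 := abs_lt.mp (Complex.abs_arg_lt_pi_div_two_iff.mpr (Or.inl hq))
  have hp := Real.pi_pos
  have hn0 : n = 0 := by
    have h1 : (n : ℝ) < 1 := by nlinarith
    have h2 : (-1 : ℝ) < n := by nlinarith
    have h1' : n < 1 := by exact_mod_cast h1
    have h2' : -1 < n := by exact_mod_cast h2
    omega
  rw [hn, hn0]; simp

lemma re_pos_of_norm_lt {q : ℂ} (h : ‖q - 1‖ < 1) : 0 < q.re := by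
  have := (abs_le.mp (Complex.abs_re_le_norm (q - 1))).1
  simp at this
  linarith

lemma div_sub_one_norm {a z z' : ℂ} (h : ‖z' - z‖ < ‖a - z‖) :
    ‖(a - z') / (a - z) - 1‖ < 1 := by
  have h0 : a - z ≠ 0 := by
    intro h'; rw [h', norm_zero] at h; exact absurd h (not_lt.mpr (norm_nonneg _))
  have : (a - z') / (a - z) - 1 = (z - z') / (a - z) := by field_simp; ring
  rw [this, norm_div, norm_sub_rev, div_lt_one (norm_pos_iff.mpr h0)]
  exact h

/-- Local constancy of the winding defect. -/
lemma defect_local {X Um Up : Set Ann} (hX : IsEAC X Um Up) (σ : unitInterval → Strip)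
    (hσ : Continuous σ) (hU : ∀ t, pr (σ t) ∈ Up) (h0 : ((σ 0).2 : ℝ) = 1)
    (h1 : ((σ 1).2 : ℝ) = 1) (z : Strip) (hz : pr z ∈ X) (L : unitInterval → ℂ)
    (hL : IsLg σ z L) :
    ∀ᶠ z' in 𝓝 z, pr z' ∈ X → ∀ L', IsLg σ z' L' →
      L' 1 - Complex.log (ct (σ 1) - ct z') = L 1 - Complex.log (ct (σ 1) - ct z) := by
  have hne : ∀ t, ct (σ t) - ct z ≠ 0 := fun t => ct_sub_ne (U_ne_X hX (hU t) hz)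
  have hc : Continuous fun t => ct (σ t) - ct z := (continuous_ct.comp hσ).sub continuous_const
  obtain ⟨t₀, -, ht₀⟩ := isCompact_univ.exists_isMinOn (s := (univ : Set unitInterval))
    ⟨0, mem_univ _⟩ (f := fun t => ‖ct (σ t) - ct z‖) hc.norm.continuousOn
  have hpos : 0 < ‖ct (σ t₀) - ct z‖ := norm_pos_iff.mpr (hne t₀)
  have hev : ∀ᶠ z' in 𝓝 z, ‖ct z' - ct z‖ < ‖ct (σ t₀) - ct z‖ := by
    have hcc : Continuous fun z' => ‖ct z' - ct z‖ := by have := continuous_ct; fun_prop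
    exact (isOpen_lt hcc continuous_const).mem_nhds (by simpa using hpos)
  filter_upwards [hev] with z' hz' hz'X L' hL'
  have hq : ∀ t, 0 < ((ct (σ t) - ct z') / (ct (σ t) - ct z)).re := fun t =>
    re_pos_of_norm_lt (div_sub_one_norm (lt_of_lt_of_le hz' (ht₀ (mem_univ t))))
  have hne' : ∀ t, ct (σ t) - ct z' ≠ 0 := fun t => ct_sub_ne (U_ne_X hX (hU t) hz'X)
  have hc' : Continuous fun t => ct (σ t) - ct z' := (continuous_ct.comp hσ).sub continuous_const
  have hlq : Continuous fun t => Complex.log ((ct (σ t) - ct z') / (ct (σ t) - ct z)) :=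
    (hc'.div hc hne).clog (fun t => Or.inl (hq t))
  have e := log_diff_const L'
    (fun t => L t + Complex.log ((ct (σ t) - ct z') / (ct (σ t) - ct z))) hL'.1
    (hL.1.add hlq) (fun t => by
      rw [hL'.2.1, Complex.exp_add, hL.2.1, Complex.exp_log (div_ne_zero (hne' t) (hne t))]
      have := hne t
      field_simp) 1 0
  have l0 := log_mul_upper (top_sub_im_pos hX h0 hz) (top_sub_im_pos hX h0 hz'X) (hq 0)
  have l1 := log_mul_upper (top_sub_im_pos hX h1 hz) (top_sub_im_pos hX h1 hz'X) (hq 1)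
  rw [hL.2.2, hL'.2.2] at e
  linear_combination e - l1 + l0

/-- Paths of `Ũ₊` from top to top do not wind around points of `X̃`. -/
lemma null_wind {X Um Up : Set Ann} (hX : IsEAC X Um Up) (σ : unitInterval → Strip)
    (hσ : Continuous σ) (hU : ∀ t, pr (σ t) ∈ Up) (h0 : ((σ 0).2 : ℝ) = 1)
    (h1 : ((σ 1).2 : ℝ) = 1) (z : Strip) (hz : pr z ∈ X) (L : unitInterval → ℂ)
    (hL : IsLg σ z L) : L 1 = Complex.log (ct (σ 1) - ct z) := by
  have hXc : IsClosed (pr ⁻¹' X) := hX.compact.isClosed.preimage continuous_pr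
  have hex : ∀ z : Strip, ∃ L, pr z ∈ X → IsLg σ z L := by
    intro z
    by_cases h : pr z ∈ X
    · obtain ⟨L, hL⟩ := exists_isLg σ hσ z (fun t => U_ne_X hX (hU t) h)
      exact ⟨L, fun _ => hL⟩
    · exact ⟨0, fun h' => absurd h' h⟩
  choose Lz hLz using hex
  set d : Strip → ℂ := fun z => Lz z 1 - Complex.log (ct (σ 1) - ct z) with hd
  have hclosed : ∀ P : ℂ → Prop, IsClosed {z | pr z ∈ X ∧ P (d z)} := by
    intro P
    rw [← closure_subset_iff_isClosed]
    intro w hw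
    have hwX : pr w ∈ X := by
      have : w ∈ closure (pr ⁻¹' X) := closure_mono (fun z hz => hz.1) hw
      rwa [hXc.closure_eq] at this
    have hloc := defect_local hX σ hσ hU h0 h1 w hwX (Lz w) (hLz w hwX)
    rw [mem_closure_iff_frequently] at hw
    obtain ⟨w', ⟨hw1, hw2⟩, hw3⟩ := (hw.and_eventually hloc).exists
    have := hw3 hw1 (Lz w') (hLz w' hw1)
    refine ⟨hwX, ?_⟩
    have e : d w' = d w := this
    rwa [← e]
  obtain ⟨B, hB⟩ : ∃ B : ℝ, ∀ t, |(σ t).1| ≤ B := by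
    obtain ⟨t₀, -, ht₀⟩ := isCompact_univ.exists_isMaxOn (s := (univ : Set unitInterval))
      ⟨0, mem_univ _⟩ (f := fun t => |(σ t).1|) (by fun_prop)
    exact ⟨_, fun t => ht₀ (mem_univ t)⟩
  have hK : {z | pr z ∈ X ∧ d z ≠ 0} = ∅ := by
    refine null_clop hX _ {z | pr z ∈ X ∧ d z = 0}ᶜ (hclosed (fun c => c = 0)).isOpen_compl ?_
      (hclosed (fun c => c ≠ 0)) B ?_
    · ext w
      simp only [mem_ofPred_eq, mem_inter_iff, mem_compl_iff, mem_preimage]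
      tauto
    · rintro w ⟨hwX, hwd⟩
      by_contra hlt
      push Not at hlt
      apply hwd
      have hLw := hLz w hwX
      have hc : Continuous fun t => ct (σ t) - ct w :=
        (continuous_ct.comp hσ).sub continuous_const
      have hne : ∀ t, ct (σ t) - ct w ≠ 0 := fun t => ct_sub_ne (U_ne_X hX (hU t) hwX)
      rcases lt_abs.mp hlt with h | h
      · have e := log_diff_const (Lz w)
          (fun t => Complex.log (-(ct (σ t) - ct w)) + Real.pi * Complex.I) hLw.1
          ((hc.neg.clog (fun t => Or.inl (by
            have := (abs_le.mp (hB t)).2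
            simp; linarith))).add continuous_const)
          (fun t => by
            rw [hLw.2.1, exp_pi_add, Complex.exp_log (neg_ne_zero.mpr (hne t)), neg_neg]) 1 0
        have l0 := log_neg_of_im_pos (top_sub_im_pos hX h0 hwX)
        have l1 := log_neg_of_im_pos (top_sub_im_pos hX h1 hwX)
        rw [hLw.2.2] at e
        simp only [hd]
        linear_combination e - l1 + l0
      · have e := log_diff_const (Lz w)
          (fun t => Complex.log (ct (σ t) - ct w)) hLw.1
          (hc.clog (fun t => Or.inl (by
            have := (abs_le.mp (hB t)).1
            simp; linarith)))
          (fun t => by rw [hLw.2.1, Complex.exp_log (hne t)]) 1 0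
        rw [hLw.2.2] at e
        simp only [hd]
        linear_combination e
  have hdz : d z = 0 := by
    by_contra h
    have : z ∈ ({z | pr z ∈ X ∧ d z ≠ 0} : Set Strip) := ⟨hz, h⟩
    rw [hK] at this; exact this
  rw [isLg_unique hL (hLz z hz)]
  exact sub_eq_zero.mp hdz

/-- The square argument common to the order lemma and the separation lemma. -/
lemma square_log (γ δ : unitInterval → Strip) (hγ : Continuous γ) (hδ : Continuous δ)
    (hd : ∀ s t, γ s ≠ δ t) (hγ0 : ((γ 0).2 : ℝ) = 1) (hδ0 : ((δ 0).2 : ℝ) = 1)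
    (hlt : (γ 0).1 < (δ 0).1) :
    ∃ G : unitInterval × unitInterval → ℂ, Continuous G ∧
      (∀ s t, Complex.exp (G (s, t)) = ct (γ s) - ct (δ t)) ∧
      (∀ t, G (0, t) = Complex.log (ct (γ 0) - ct (δ t))) ∧
      (∀ s, G (s, 0) = Complex.log (ct (δ 0) - ct (γ s)) + Real.pi * Complex.I) := by
  have hcγ := continuous_ct.comp hγ
  have hcδ := continuous_ct.comp hδ
  obtain ⟨G, hG, hGe, hG0⟩ := exists_log_II (fun p => ct (γ p.1) - ct (δ p.2))
    ((hcγ.comp continuous_fst).sub (hcδ.comp continuous_snd))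
    (fun p => ct_sub_ne (hd _ _)) (0, 0) _ (Complex.exp_log (ct_sub_ne (hd 0 0)))
  refine ⟨G, hG, fun s t => hGe (s, t), ?_, ?_⟩
  · intro t
    have hh : Continuous fun t => ct (γ 0) - ct (δ t) := continuous_const.sub hcδ
    have := log_unique (fun t => G (0, t)) (fun t => Complex.log (ct (γ 0) - ct (δ t)))
      (by fun_prop) (continuous_log_upper _ hh (fun t => top_sub_im hγ0)
        (fun t => ct_sub_ne (hd 0 t)))
      (fun t => by rw [hGe, Complex.exp_log (ct_sub_ne (hd 0 t))]) 0 hG0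
    exact congrFun this t
  · intro s
    have hh : Continuous fun s => ct (δ 0) - ct (γ s) := continuous_const.sub hcγ
    have hne : ∀ s, ct (δ 0) - ct (γ s) ≠ 0 := fun s => ct_sub_ne (hd s 0).symm
    have := log_unique (fun s => G (s, 0))
      (fun s => Complex.log (ct (δ 0) - ct (γ s)) + Real.pi * Complex.I)
      (by fun_prop) ((continuous_log_upper _ hh (fun t => top_sub_im hδ0) hne).add
        continuous_const)
      (fun s => by rw [hGe, exp_pi_add, Complex.exp_log (hne s)]; ring) 0 (by
        show G (0, 0) = _
        rw [hG0]
        have := log_neg_of_re (w := ct (γ 0) - ct (δ 0)) (by simpa using hlt)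
          (by simp [hγ0, hδ0])
        rw [this, neg_sub])
    exact congrFun this s

/-- Order lemma for a pair of disjoint access paths. -/
lemma pair_log (γ δ : unitInterval → Strip) (hγ : Continuous γ) (hδ : Continuous δ)
    (hd : ∀ s t, γ s ≠ δ t) (hγ0 : ((γ 0).2 : ℝ) = 1) (hδ0 : ((δ 0).2 : ℝ) = 1)
    (hlt : (γ 0).1 < (δ 0).1) (La Lb : unitInterval → ℂ) (hLa : IsLg γ (δ 1) La)
    (hLb : IsLg δ (γ 1) Lb) : La 1 = Lb 1 + Real.pi * Complex.I := by
  obtain ⟨G, hG, hGe, hG1, hG2⟩ := square_log γ δ hγ hδ hd hγ0 hδ0 hlt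
  have e1 := log_unique La (fun s => G (s, 1)) hLa.1 (by fun_prop)
    (fun s => by rw [hLa.2.1, hGe]) 0 (by rw [hLa.2.2, hG1])
  have e2 := log_unique (fun t => Lb t + Real.pi * Complex.I) (fun t => G (1, t))
    (hLb.1.add continuous_const) (by fun_prop)
    (fun t => by rw [exp_pi_add, hLb.2.1, hGe]; ring) 0 (by
      show Lb 0 + _ = _
      rw [hLb.2.2, hG2])
  have f1 : La 1 = G (1, 1) := congrFun e1 1
  have f2 : Lb 1 + Real.pi * Complex.I = G (1, 1) := congrFun e2 1
  rw [f1, f2]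

/-- Separation: an access path separates the left top from the right top. -/
lemma sep {X Um Up : Set Ann} (hX : IsEAC X Um Up) (σ τ : unitInterval → Strip)
    (hσ : Continuous σ) (hτ : Continuous τ) (hd : ∀ s t, σ s ≠ τ t)
    (hU : ∀ t, pr (σ t) ∈ Up) (h0 : ((σ 0).2 : ℝ) = 1)
    (h1 : ((σ 1).2 : ℝ) = 1) (hτ0 : ((τ 0).2 : ℝ) = 1) (hτ1 : pr (τ 1) ∈ X)
    (hlt : (σ 0).1 < (τ 0).1) (hlt2 : (τ 0).1 < (σ 1).1) : False := by
  obtain ⟨G, hG, hGe, hG1, hG2⟩ := square_log σ τ hσ hτ hd h0 hτ0 hlt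
  have hn := null_wind hX σ hσ hU h0 h1 (τ 1) hτ1 (fun s => G (s, 1))
    ⟨by fun_prop, fun s => hGe s 1, hG1 1⟩
  have hh : Continuous fun t => ct (σ 1) - ct (τ t) :=
    continuous_const.sub (continuous_ct.comp hτ)
  have e := log_diff_const (fun t => G (1, t)) (fun t => Complex.log (ct (σ 1) - ct (τ t)))
    (by fun_prop) (continuous_log_upper _ hh (fun t => top_sub_im h1)
        (fun t => ct_sub_ne (hd 1 t)))
    (fun t => by rw [hGe, Complex.exp_log (ct_sub_ne (hd 1 t))]) 1 0
  rw [hn, sub_self, hG2] at e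
  have l := log_neg_of_re (w := ct (τ 0) - ct (σ 1)) (by simpa using hlt2)
          (by simp [hτ0, h1])
  rw [neg_sub] at l
  have : (2 * Real.pi * Complex.I : ℂ) = 0 := by linear_combination -e - l
  exact Complex.two_pi_I_ne_zero this

/-- Two paths with common points arbitrarily close to their ends. -/
def Meet (τ τ' : unitInterval → Strip) : Prop :=
  ∀ d : ℝ, d < 1 → ∃ s t : unitInterval, d < s ∧ d < t ∧ s ≠ 1 ∧ t ≠ 1 ∧ τ s = τ' t

/-- Concatenation of `a` on `[0,s]` with the reverse of `b` on `[0,t]`. -/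
noncomputable def joinRev {Y : Type*} (a b : unitInterval → Y) (s t : unitInterval) :
    unitInterval → Y := fun r =>
  if (r : ℝ) ≤ 1 / 2 then a (Set.projIcc (0 : ℝ) 1 zero_le_one (2 * s * r))
  else b (Set.projIcc (0 : ℝ) 1 zero_le_one (t * (2 - 2 * r)))

lemma joinRev_cont {Y : Type*} [TopologicalSpace Y] {a b : unitInterval → Y} (ha : Continuous a)
    (hb : Continuous b) {s t : unitInterval} (h : a s = b t) : Continuous (joinRev a b s t) := by
  unfold joinRev
  refine Continuous.if_le ?_ ?_ (by fun_prop) continuous_const ?_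
  · exact ha.comp (continuous_projIcc.comp (by fun_prop))
  · exact hb.comp (continuous_projIcc.comp (by fun_prop))
  · intro r hr
    have e1 : 2 * (s : ℝ) * r = s := by rw [hr]; ring
    have e2 : (t : ℝ) * (2 - 2 * r) = t := by rw [hr]; ring
    rw [e1, e2]
    rw [Set.projIcc_val (zero_le_one' ℝ) s, Set.projIcc_val (zero_le_one' ℝ) t]
    exact h

lemma joinRev_zero {Y : Type*} (a b : unitInterval → Y) (s t : unitInterval) :
    joinRev a b s t 0 = a 0 := by
  unfold joinRev
  simp

lemma joinRev_one {Y : Type*} (a b : unitInterval → Y) (s t : unitInterval) :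
    joinRev a b s t 1 = b 0 := by
  unfold joinRev
  have : ¬ ((1 : unitInterval) : ℝ) ≤ 1 / 2 := by norm_num
  rw [if_neg this]
  simp

lemma joinRev_mem {Y : Type*} (a b : unitInterval → Y) (s t : unitInterval) (hs : s ≠ 1)
    (ht : t ≠ 1) (S : Set Y) (ha : ∀ r, r ≠ 1 → a r ∈ S) (hb : ∀ r, r ≠ 1 → b r ∈ S)
    (r : unitInterval) : joinRev a b s t r ∈ S := by
  have hs1 : (s : ℝ) < 1 := lt_of_le_of_ne s.2.2 (fun h => hs (Subtype.ext h))
  have ht1 : (t : ℝ) < 1 := lt_of_le_of_ne t.2.2 (fun h => ht (Subtype.ext h))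
  have h0 := r.2.1
  have h1 := r.2.2
  have hs0 := s.2.1
  have ht0 := t.2.1
  have aux : ∀ x : ℝ, 0 ≤ x → x < 1 → Set.projIcc (0 : ℝ) 1 zero_le_one x ≠ 1 := by
    intro x hx0 hx1 h
    rw [Set.projIcc_of_mem zero_le_one ⟨hx0, hx1.le⟩] at h
    have := congrArg Subtype.val h
    simp at this; linarith
  unfold joinRev
  split_ifs with h
  · apply ha
    apply aux
    · positivity
    · nlinarith
  · push Not at h
    apply hb
    apply aux
    · apply mul_nonneg ht0; linarith
    · nlinarith

lemma joinRev_comp {Y Z : Type*} (a b : unitInterval → Y) (s t : unitInterval) (g : Y → Z)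
    (r : unitInterval) : g (joinRev a b s t r) = joinRev (fun x => g (a x)) (fun x => g (b x)) s t r := by
  unfold joinRev
  split_ifs <;> rfl

/-- Two access paths which meet near the end have the same normalized logarithm. -/
lemma meet_log {X Um Up : Set Ann} (hX : IsEAC X Um Up) (τ τ' : unitInterval → Strip)
    (hτ : Continuous τ) (hτ' : Continuous τ') (hU : ∀ t, t ≠ 1 → pr (τ t) ∈ Up)
    (hU' : ∀ t, t ≠ 1 → pr (τ' t) ∈ Up) (h0 : ((τ 0).2 : ℝ) = 1) (h0' : ((τ' 0).2 : ℝ) = 1)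
    (hend : τ 1 = τ' 1) (hm : Meet τ τ') (z : Strip) (hz : pr z ∈ X) (hzy : τ 1 ≠ z)
    (L L' : unitInterval → ℂ) (hL : IsLg τ z L) (hL' : IsLg τ' z L') : L 1 = L' 1 := by
  have hpos : 0 < ‖ct (τ 1) - ct z‖ := norm_pos_iff.mpr (ct_sub_ne hzy)
  have near : ∀ (κ : unitInterval → Strip), Continuous κ → κ 1 = τ 1 →
      ∃ d : ℝ, d < 1 ∧ ∀ s : unitInterval, d < s → ‖ct (κ s) - ct (τ 1)‖ < ‖ct (τ 1) - ct z‖ := by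
    intro κ hκ hκ1
    have hc : Continuous fun s => ‖ct (κ s) - ct (τ 1)‖ := by have := continuous_ct; fun_prop
    have : {s | ‖ct (κ s) - ct (τ 1)‖ < ‖ct (τ 1) - ct z‖} ∈ 𝓝 (1 : unitInterval) :=
      (isOpen_lt hc continuous_const).mem_nhds (by simpa [hκ1] using hpos)
    obtain ⟨ε, hε, hsub⟩ := Metric.mem_nhds_iff.mp this
    refine ⟨1 - ε, by linarith, fun s hs => hsub ?_⟩
    rw [Metric.mem_ball, Subtype.dist_eq, Real.dist_eq, abs_lt]
    have := s.2.2
    constructor <;> simp <;> linarith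
  obtain ⟨d, hd, hdn⟩ := near τ hτ rfl
  obtain ⟨d', hd', hdn'⟩ := near τ' hτ' hend.symm
  obtain ⟨s, t, hs, ht, hs1, ht1, hst⟩ := hm (max d d') (max_lt hd hd')
  -- behaviour on the tails
  have tail : ∀ (κ : unitInterval → Strip) (M : unitInterval → ℂ) (d : ℝ) (s : unitInterval),
      Continuous κ → κ 1 = τ 1 → IsLg κ z M → d < s →
      (∀ s : unitInterval, d < s → ‖ct (κ s) - ct (τ 1)‖ < ‖ct (τ 1) - ct z‖) →
      M 1 = M s - Complex.log ((ct (κ s) - ct z) / (ct (τ 1) - ct z)) := by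
    intro κ M d s hκ hκ1 hM hds hn
    have : PreconnectedSpace (Set.Ici s) := Subtype.preconnectedSpace isPreconnected_Ici
    have hq : ∀ r : Set.Ici s, ‖(ct (κ r) - ct z) / (ct (τ 1) - ct z) - 1‖ < 1 := by
      intro r
      have h1 := hn r (lt_of_lt_of_le hds r.2)
      have h2 : (ct (κ r) - ct z) / (ct (τ 1) - ct z) - 1
          = (ct (κ r) - ct (τ 1)) / (ct (τ 1) - ct z) := by
        have := norm_pos_iff.mp hpos
        field_simp; ring
      rw [h2, norm_div, div_lt_one hpos]
      exact h1
    have hne : ∀ r : Set.Ici s, (ct (κ r) - ct z) / (ct (τ 1) - ct z) ≠ 0 := fun r h => by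
      have := re_pos_of_norm_lt (hq r); rw [h] at this; simp at this
    have hcq : Continuous fun r : Set.Ici s => (ct (κ r) - ct z) / (ct (τ 1) - ct z) := by
      have h1 : Continuous fun r : Set.Ici s => ct (κ r) :=
        continuous_ct.comp (hκ.comp continuous_subtype_val)
      fun_prop
    have e := log_diff_const (fun r : Set.Ici s => M r)
      (fun r : Set.Ici s => Complex.log ((ct (κ r) - ct z) / (ct (τ 1) - ct z))
        + Complex.log (ct (τ 1) - ct z))
      (hM.1.comp continuous_subtype_val)
      ((hcq.clog (fun r => Or.inl (re_pos_of_norm_lt (hq r)))).add continuous_const)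
      (fun r => by
        rw [hM.2.1, Complex.exp_add, Complex.exp_log (hne r),
          Complex.exp_log (norm_pos_iff.mp hpos)]
        have := norm_pos_iff.mp hpos
        field_simp) ⟨1, s.2.2⟩ ⟨s, le_refl s⟩
    simp only [hκ1] at e
    rw [div_self (norm_pos_iff.mp hpos), Complex.log_one] at e
    linear_combination e
  have t1 := tail τ L d s hτ rfl hL (lt_of_le_of_lt (le_max_left _ _) hs) hdn
  have t2 := tail τ' L' d' t hτ' hend.symm hL' (lt_of_le_of_lt (le_max_right _ _) ht) hdn'
  rw [hst] at t1
  have hexp : Complex.exp (L s - L' t) = 1 := by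
    rw [Complex.exp_sub, hL.2.1, hL'.2.1, hst]
    exact div_self (ct_sub_ne (U_ne_X hX (hU' t ht1) hz))
  have hn := null_wind hX (joinRev τ τ' s t) (joinRev_cont hτ hτ' hst)
    (fun r => joinRev_mem τ τ' s t hs1 ht1 (pr ⁻¹' Up) hU hU' r)
    (by rw [joinRev_zero]; exact h0) (by rw [joinRev_one]; exact h0') z hz
    (joinRev L (fun r => L' r + (L s - L' t)) s t)
    ⟨joinRev_cont hL.1 (hL'.1.add continuous_const)
      (by show L s = L' t + (L s - L' t); ring), fun r => by
      rw [joinRev_comp _ _ _ _ Complex.exp, joinRev_comp _ _ _ _ (fun p => ct p - ct z)]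
      unfold joinRev
      split_ifs
      · exact hL.2.1 _
      · show Complex.exp (L' _ + (L s - L' t)) = ct (τ' _) - ct z
        rw [Complex.exp_add, hexp, mul_one, hL'.2.1], by
      rw [joinRev_zero, joinRev_zero, hL.2.2]⟩
  rw [joinRev_one, joinRev_one, hL'.2.2] at hn
  linear_combination t1 - t2 + hn

/-- `e` is the top height of `X̃` over `0`. -/
def Et (X : Set Ann) (e : II) : Prop :=
  pr ((0 : ℝ), e) ∈ X ∧ ∀ z : Strip, pr z ∈ X → z.1 = 0 → z.2 ≤ e

/-- The fundamental open domain. -/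
def DD (Up : Set Ann) (e : II) (j : ℤ) : Set Strip :=
  shiftSet j (connectedComponentIn (pr ⁻¹' Up \ (betaP e ∪ shiftSet 1 (betaP e))) topSeg)

/-- Vertical hairs. -/
def BB (e : II) (j : ℤ) : Set Strip := {z : Strip | z.1 = j ∧ e < z.2}

lemma mem_BB {e : II} {j : ℤ} {z : Strip} : z ∈ BB e j ↔ z.1 = j ∧ e < z.2 := Iff.rfl

lemma shift_beta (e : II) (j : ℤ) : shiftSet j (betaP e) = BB e j := by
  ext z
  rw [mem_shiftSet, mem_BB]
  unfold betaP
  simp only [mem_ofPred_eq, shiftPt_fst, shiftPt_snd]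
  push_cast
  constructor
  · rintro ⟨h1, h2⟩; exact ⟨by linarith, h2⟩
  · rintro ⟨h1, h2⟩; exact ⟨by linarith, h2⟩

lemma Et_X {X : Set Ann} {e : II} (he : Et X e) (j : ℤ) : pr ((j : ℝ), e) ∈ X := by
  have := he.1
  rw [← pr_shift j] at this
  simpa [shiftPt] using this

lemma Et_le {X : Set Ann} {e : II} (he : Et X e) (j : ℤ) (z : Strip) (hz : pr z ∈ X)
    (h : z.1 = j) : z.2 ≤ e := by
  refine he.2 (shiftPt (-j) z) (by simpa using hz) ?_
  simp [h]

lemma e_lt {X Um Up : Set Ann} (hX : IsEAC X Um Up) {e : II} (he : Et X e) : (e : ℝ) < 1 :=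
  X_lt_one hX he.1

lemma preconn_Ici (y : II) : IsPreconnected (Ici y) := by
  have h : (Ici y : Set II) = Set.projIcc (-1 : ℝ) 1 (by norm_num) '' Icc (y : ℝ) 1 := by
    ext t; constructor
    · intro ht; exact ⟨t, ⟨ht, t.2.2⟩, Set.projIcc_val (by norm_num) t⟩
    · rintro ⟨x, hx, rfl⟩
      rw [Set.projIcc_of_mem (by norm_num) ⟨y.2.1.trans hx.1, hx.2⟩]
      exact hx.1
  rw [h]
  exact isPreconnected_Icc.image _ continuous_projIcc.continuousOn

lemma BB_U {X Um Up : Set Ann} (hX : IsEAC X Um Up) {e : II} (he : Et X e) {j : ℤ} {z : Strip}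
    (hz : z ∈ BB e j) : pr z ∈ Up := by
  have hT : IsPreconnected ((fun y : II => pr ((j : ℝ), y)) '' Ici z.2) :=
    (preconn_Ici z.2).image _
      (continuous_pr.comp (g := pr) (f := fun y : II => (((j : ℝ), y) : Strip))
        (by fun_prop)).continuousOn
  have hsub : ((fun y : II => pr ((j : ℝ), y)) '' Ici z.2) ⊆ Xᶜ := by
    rintro _ ⟨y, hy, rfl⟩ hx
    have := Et_le he j _ hx rfl
    exact absurd (lt_of_lt_of_le hz.2 (hy.trans this)) (lt_irrefl _)
  have htop : pr (tp j) ∈ ((fun y : II => pr ((j : ℝ), y)) '' Ici z.2) :=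
    ⟨_, z.2.2.2, rfl⟩
  have h0 := tp_mem hX j
  rw [hX.hUp] at h0 ⊢
  rw [connectedComponentIn_eq h0]
  refine hT.subset_connectedComponentIn htop hsub ⟨z.2, le_refl z.2, ?_⟩
  rw [← hz.1]

/-- The vertical access path. -/
noncomputable def bt (e : II) (j : ℤ) (t : unitInterval) : Strip :=
  ((j : ℝ), ⟨1 - t * (1 - e), by have := e.2.1; have := e.2.2; have := t.2.1; have := t.2.2; nlinarith,
    by have := e.2.1; have := e.2.2; have := t.2.1; have := t.2.2; nlinarith⟩)

lemma continuous_bt (e : II) (j : ℤ) : Continuous (bt e j) := by unfold bt; fun_prop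

lemma bt_zero (e : II) (j : ℤ) : bt e j 0 = tp j := by
  unfold bt tp; refine Prod.ext rfl (Subtype.ext ?_); simp

lemma bt_one (e : II) (j : ℤ) : bt e j 1 = ((j : ℝ), e) := by
  unfold bt; refine Prod.ext rfl (Subtype.ext ?_); simp

lemma bt_mem {e : II} (he : (e : ℝ) < 1) (j : ℤ) (t : unitInterval) (ht : t ≠ 1) :
    bt e j t ∈ BB e j := by
  refine ⟨rfl, ?_⟩
  show (e : ℝ) < 1 - t * (1 - e)
  have : (t : ℝ) < 1 := lt_of_le_of_ne t.2.2 (fun h => ht (Subtype.ext h))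
  nlinarith

lemma bt_inj {e : II} (he : (e : ℝ) < 1) (j : ℤ) : Function.Injective (bt e j) := by
  intro s t h
  have h2 := congrArg (fun z : Strip => (z.2 : ℝ)) h
  simp only [bt] at h2
  apply Subtype.ext
  have : (1 - (e : ℝ)) ≠ 0 := by linarith
  apply mul_right_cancel₀ this
  linarith

lemma bt_surj {e : II} {j : ℤ} {z : Strip} (hz : z ∈ BB e j) : ∃ t, t ≠ 1 ∧ bt e j t = z := by
  have h2 : (e : ℝ) < z.2 := hz.2
  have h3 := z.2.2.2
  have h4 : (0 : ℝ) < 1 - e := by linarith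
  refine ⟨⟨(1 - z.2) / (1 - e), div_nonneg (by linarith) h4.le, (div_le_one h4).mpr (by linarith)⟩,
    ?_, ?_⟩
  · intro h
    have := congrArg Subtype.val h
    change (1 - (z.2 : ℝ)) / (1 - e) = 1 at this
    rw [div_eq_one_iff_eq h4.ne'] at this
    linarith
  · refine Prod.ext hz.1.symm (Subtype.ext ?_)
    simp only [bt]
    field_simp
    ring

lemma bt_arc {X Um Up : Set Ann} (hX : IsEAC X Um Up) {e : II} (he : Et X e) (j : ℤ) :
    IsArcTo (pr ⁻¹' Up) (bt e j) ((j : ℝ), e) :=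
  ⟨continuous_bt e j, bt_inj (e_lt hX he) j,
    fun t ht => BB_U hX he (bt_mem (e_lt hX he) j t ht), bt_one e j⟩

lemma BB_disj {e : II} {i j : ℤ} (h : i ≠ j) {z : Strip} (h1 : z ∈ BB e i) (h2 : z ∈ BB e j) :
    False := by
  apply h
  have := h1.1.symm.trans h2.1
  exact_mod_cast this

lemma BB_path {e : II} (he : (e : ℝ) < 1) (j : ℤ) : IsPathConnected (BB e j) := by
  have : BB e j = bt e j '' {t | t ≠ 1} := by
    ext z; constructor
    · intro hz; obtain ⟨t, ht, h⟩ := bt_surj hz; exact ⟨t, ht, h⟩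
    · rintro ⟨t, ht, rfl⟩; exact bt_mem he j t ht
  rw [this]
  have h2 : ({t | t ≠ 1} : Set unitInterval) = Iio 1 := by
    ext t; simp [lt_iff_le_and_ne, unitInterval.le_one']
  rw [h2]
  refine IsPathConnected.image' ?_ (continuous_bt e j).continuousOn
  have h3 : IsPathConnected (Ico (0 : ℝ) 1) := (convex_Ico 0 1).isPathConnected ⟨0, by simp⟩
  have : (Iio 1 : Set unitInterval) = Set.projIcc (0 : ℝ) 1 zero_le_one '' Ico (0 : ℝ) 1 := by
    ext t; constructor
    · intro ht; exact ⟨t, ⟨t.2.1, ht⟩, Set.projIcc_val zero_le_one t⟩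
    · rintro ⟨x, hx, rfl⟩
      rw [Set.projIcc_of_mem zero_le_one ⟨hx.1, hx.2.le⟩]
      exact hx.2
  rw [this]
  exact h3.image' continuous_projIcc.continuousOn

/-- Separation by vertical hairs. -/
lemma topsep {X Um Up : Set Ann} (hX : IsEAC X Um Up) {e : II} (he : Et X e) (K : Set Strip)
    (hK : IsPathConnected K) (hKU : K ⊆ pr ⁻¹' Up) (j : ℤ) (hKB : Disjoint K (BB e j)) (a b : ℝ)
    (ha : tp a ∈ K) (hb : tp b ∈ K) (haj : a < j) (hjb : (j : ℝ) < b) : False := by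
  obtain ⟨p, hp⟩ := hK.joinedIn _ ha _ hb
  refine sep hX p (bt e j) p.continuous (continuous_bt e j) ?_ (fun t => hKU (hp t))
    (by simp) (by simp) (by rw [bt_zero]; rfl) (by rw [bt_one]; exact Et_X he j)
    (by rw [bt_zero]; simpa using haj) (by rw [bt_zero]; simpa using hjb)
  intro s t h
  by_cases ht : t = 1
  · rw [ht, bt_one] at h
    exact U_ne_X hX (hKU (hp s)) (Et_X he j) h
  · exact Set.disjoint_left.mp hKB (hp s) (h ▸ bt_mem (e_lt hX he) j t ht)

lemma isOpen_U {X Um Up : Set Ann} (hX : IsEAC X Um Up) : IsOpen (pr ⁻¹' Up) :=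
  (isOpen_Up hX).preimage continuous_pr

/-- The closed union of all hairs. -/
def CC (e : II) : Set Strip := {z : Strip | z.1 ∈ range (Int.cast : ℤ → ℝ) ∧ e ≤ z.2}

lemma isClosed_CC (e : II) : IsClosed (CC e) :=
  ((Int.isClosedEmbedding_coe_real.isClosed_range).preimage continuous_fst).inter
    ((isClosed_Ici (a := e)).preimage continuous_snd)

lemma BB_CC {e : II} {j : ℤ} : BB e j ⊆ CC e := fun _ hz => ⟨⟨j, hz.1.symm⟩, hz.2.le⟩

lemma CC_U {X Um Up : Set Ann} (hX : IsEAC X Um Up) {e : II} (he : Et X e) {z : Strip}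
    (hz : z ∈ CC e) (hU : pr z ∈ Up) : ∃ j, z ∈ BB e j := by
  obtain ⟨⟨j, hj⟩, h2⟩ := hz
  refine ⟨j, hj.symm, lt_of_le_of_ne h2 ?_⟩
  intro h
  have : z = ((j : ℝ), e) := Prod.ext hj.symm h.symm
  exact U_ne_X hX hU (Et_X he j) this

/-- the base domain -/
lemma base_open {X Um Up : Set Ann} (hX : IsEAC X Um Up) {e : II} (he : Et X e) :
    IsOpen (pr ⁻¹' Up \ (betaP e ∪ shiftSet 1 (betaP e))) := by
  have h0 : betaP e = BB e 0 := by rw [← shift_beta]; simp [shiftSet]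
  have : pr ⁻¹' Up \ (betaP e ∪ shiftSet 1 (betaP e)) =
      pr ⁻¹' Up ∩ {z : Strip | (z.1 = 0 ∨ z.1 = 1) ∧ e ≤ z.2}ᶜ := by
    rw [shift_beta, h0]
    ext z
    constructor
    · rintro ⟨h1, h2⟩
      refine ⟨h1, ?_⟩
      rintro ⟨h3, h4⟩
      have hC : z ∈ CC e := ⟨by
        rcases h3 with h | h
        · exact ⟨0, by simp [h]⟩
        · exact ⟨1, by simp [h]⟩, h4⟩
      obtain ⟨j, hj⟩ := CC_U hX he hC h1
      apply h2
      rcases h3 with h | h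
      · left; exact ⟨by simp [h], hj.2⟩
      · right; exact ⟨by simp [h], hj.2⟩
    · rintro ⟨h1, h2⟩
      refine ⟨h1, ?_⟩
      rintro (h | h)
      · exact h2 ⟨Or.inl (by simpa using h.1), h.2.le⟩
      · exact h2 ⟨Or.inr (by simpa using h.1), h.2.le⟩
  rw [this]
  refine (isOpen_U hX).inter (isOpen_compl_iff.mpr ?_)
  exact ((isClosed_eq continuous_fst continuous_const).union
    (isClosed_eq continuous_fst continuous_const)).inter
      ((isClosed_Ici (a := e)).preimage continuous_snd)

lemma isOpen_shift {S : Set Strip} (hS : IsOpen S) (j : ℤ) : IsOpen (shiftSet j S) := by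
  have : shiftSet j S = shiftPt (-j) ⁻¹' S := by ext z; exact mem_shiftSet
  rw [this]; exact hS.preimage (continuous_shiftPt _)

lemma topSeg_mem {X Um Up : Set Ann} (hX : IsEAC X Um Up) {e : II} :
    topSeg ∈ pr ⁻¹' Up \ (betaP e ∪ shiftSet 1 (betaP e)) := by
  have h0 : betaP e = BB e 0 := by rw [← shift_beta]; simp [shiftSet]
  refine ⟨tp_mem hX (1 / 2), ?_⟩
  rw [shift_beta, h0]
  rintro (h | h)
  · have := h.1; simp [topSeg] at this
  · have := h.1; simp [topSeg] at this

lemma DD_open {X Um Up : Set Ann} (hX : IsEAC X Um Up) {e : II} (he : Et X e) (j : ℤ) :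
    IsOpen (DD Up e j) :=
  isOpen_shift (base_open hX he).connectedComponentIn j

lemma DD_conn {X Um Up : Set Ann} (hX : IsEAC X Um Up) (e : II) (j : ℤ) :
    IsConnected (DD Up e j) :=
  (isConnected_connectedComponentIn_iff.mpr (topSeg_mem hX)).image _
    (continuous_shiftPt j).continuousOn

lemma DD_path {X Um Up : Set Ann} (hX : IsEAC X Um Up) {e : II} (he : Et X e) (j : ℤ) :
    IsPathConnected (DD Up e j) :=
  (DD_open hX he j).isConnected_iff_isPathConnected.mp (DD_conn hX e j)

lemma DD_U {Up : Set Ann} {e : II} {j : ℤ} {z : Strip} (hz : z ∈ DD Up e j) : pr z ∈ Up := by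
  obtain ⟨w, hw, rfl⟩ := hz
  rw [pr_shift]
  exact (connectedComponentIn_subset _ _ hw).1

lemma beta_shift_mem {e : II} {j : ℤ} {w : Strip} :
    (w ∈ betaP e ∪ shiftSet 1 (betaP e)) ↔
      (shiftPt j w ∈ BB e j ∨ shiftPt j w ∈ BB e (j + 1)) := by
  have h0 : betaP e = BB e 0 := by rw [← shift_beta]; simp [shiftSet]
  rw [mem_union, shift_beta, h0, mem_BB, mem_BB, mem_BB, mem_BB]
  simp only [shiftPt_fst, shiftPt_snd]
  push_cast
  have a1 : w.1 + j = j ↔ w.1 = 0 := by constructor <;> intro h <;> linarith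
  have a2 : w.1 + j = j + 1 ↔ w.1 = 1 := by constructor <;> intro h <;> linarith
  rw [a1, a2]

lemma DD_avoid {Up : Set Ann} {e : II} {j : ℤ} {z : Strip} (hz : z ∈ DD Up e j) :
    z ∉ BB e j ∧ z ∉ BB e (j + 1) := by
  obtain ⟨w, hw, rfl⟩ := hz
  have h := (connectedComponentIn_subset _ _ hw).2
  rw [beta_shift_mem (j := j)] at h
  tauto

lemma DD_max {Up : Set Ann} {e : II} {j : ℤ} {S : Set Strip} (hS : IsPreconnected S)
    (hSU : S ⊆ pr ⁻¹' Up) (h1 : ∀ z ∈ S, z ∉ BB e j) (h2 : ∀ z ∈ S, z ∉ BB e (j + 1))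
    {z : Strip} (hz : z ∈ S) (hzD : z ∈ DD Up e j) : S ⊆ DD Up e j := by
  have hS' : IsPreconnected (shiftPt (-j) '' S) :=
    hS.image _ (continuous_shiftPt _).continuousOn
  have hsub : shiftPt (-j) '' S ⊆ pr ⁻¹' Up \ (betaP e ∪ shiftSet 1 (betaP e)) := by
    rintro _ ⟨w, hw, rfl⟩
    refine ⟨by simpa using hSU hw, ?_⟩
    rw [beta_shift_mem (j := j), shiftPt_shiftPt]
    simp only [add_neg_cancel, shiftPt_zero]
    rintro (h | h)
    · exact h1 w hw h
    · exact h2 w hw h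
  have hzD' := mem_shiftSet.mp hzD
  have := hS'.subset_connectedComponentIn (mem_image_of_mem _ hz) hsub
  rw [← connectedComponentIn_eq hzD'] at this
  intro w hw
  exact mem_shiftSet.mpr (this (mem_image_of_mem _ hw))

lemma tp_DD {X Um Up : Set Ann} (hX : IsEAC X Um Up) {e : II} {j : ℤ} {x : ℝ}
    (h1 : j < x) (h2 : x < j + 1) : tp x ∈ DD Up e j := by
  have hm : tp (j + 1 / 2) ∈ DD Up e j := by
    rw [DD, mem_shiftSet]
    have : shiftPt (-j) (tp (j + 1 / 2)) = topSeg := by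
      unfold shiftPt tp topSeg
      refine Prod.ext ?_ rfl
      push_cast; ring
    rw [this]
    exact mem_connectedComponentIn (topSeg_mem hX)
  have hS : IsPreconnected (tp '' Ioo (j : ℝ) (j + 1)) :=
    isPreconnected_Ioo.image _ continuous_tp.continuousOn
  refine DD_max hS ?_ ?_ ?_ (z := tp (j + 1 / 2)) ⟨j + 1 / 2, ⟨by linarith, by linarith⟩, rfl⟩ hm
    ⟨x, ⟨h1, h2⟩, rfl⟩
  · rintro _ ⟨y, hy, rfl⟩; exact tp_mem hX y
  · rintro _ ⟨y, hy, rfl⟩ h; have := h.1; simp at this; linarith [hy.1]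
  · rintro _ ⟨y, hy, rfl⟩ h; have := h.1; simp at this; linarith [hy.2]

lemma tp_BB {X Um Up : Set Ann} (hX : IsEAC X Um Up) {e : II} (he : Et X e) (j : ℤ) :
    tp j ∈ BB e j := ⟨rfl, e_lt hX he⟩

lemma DD_BB {X Um Up : Set Ann} (hX : IsEAC X Um Up) {e : II} (he : Et X e) {i j : ℤ} {z : Strip}
    (h1 : z ∈ DD Up e j) (h2 : z ∈ BB e i) : False := by
  have hK : IsPathConnected (DD Up e j ∪ BB e i) :=
    (DD_path hX he j).union (BB_path (e_lt hX he) i) ⟨z, h1, h2⟩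
  have hKU : DD Up e j ∪ BB e i ⊆ pr ⁻¹' Up := by
    rintro w (h | h)
    · exact DD_U h
    · exact BB_U hX he h
  have ht : tp (j + 1 / 2) ∈ DD Up e j ∪ BB e i :=
    Or.inl (tp_DD hX (by linarith) (by linarith))
  have ht' : tp i ∈ DD Up e j ∪ BB e i := Or.inr (tp_BB hX he i)
  have hn := DD_avoid h1
  have hij : i ≠ j := by rintro rfl; exact hn.1 h2
  have hij' : i ≠ j + 1 := by rintro rfl; exact hn.2 h2
  rcases lt_or_gt_of_ne hij with h | h
  · refine topsep hX he _ hK hKU j ?_ _ _ ht' ht (by exact_mod_cast h) (by linarith)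
    rw [Set.disjoint_left]
    rintro w (hw | hw) hw'
    · exact (DD_avoid hw).1 hw'
    · exact BB_disj hij hw hw'
  · have h' : j + 1 < i := by omega
    have h'' : ((j + 1 : ℤ) : ℝ) < i := by exact_mod_cast h'
    refine topsep hX he _ hK hKU (j + 1) ?_ _ _ ht ht' (by push_cast; linarith) h''
    rw [Set.disjoint_left]
    rintro w (hw | hw) hw'
    · exact (DD_avoid hw).2 hw'
    · exact BB_disj hij' hw hw'

lemma DD_disj {X Um Up : Set Ann} (hX : IsEAC X Um Up) {e : II} (he : Et X e) {i j : ℤ} {z : Strip}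
    (h1 : z ∈ DD Up e i) (h2 : z ∈ DD Up e j) : i = j := by
  have key : ∀ i j : ℤ, i < j → z ∈ DD Up e i → z ∈ DD Up e j → False := by
    intro i j hij h1 h2
    have hK : IsPathConnected (DD Up e i ∪ DD Up e j) :=
      (DD_path hX he i).union (DD_path hX he j) ⟨z, h1, h2⟩
    have h' : ((i + 1 : ℤ) : ℝ) ≤ j := by exact_mod_cast hij
    refine topsep hX he _ hK ?_ (i + 1) ?_ (i + 1 / 2) (j + 1 / 2)
      (Or.inl (tp_DD hX (by linarith) (by linarith)))
      (Or.inr (tp_DD hX (by linarith) (by linarith))) (by push_cast; linarith) (by linarith)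
    · rintro w (h | h)
      · exact DD_U h
      · exact DD_U h
    · rw [Set.disjoint_left]
      rintro w (hw | hw) hw'
      · exact DD_BB hX he hw hw'
      · exact DD_BB hX he hw hw'
  rcases lt_trichotomy i j with h | h | h
  · exact (key i j h h1 h2).elim
  · exact h
  · exact (key j i h h2 h1).elim

/-- Rectangles around hairs. -/
lemma BB_rect {X Um Up : Set Ann} (hX : IsEAC X Um Up) {e : II} (he : Et X e) {j : ℤ} {z : Strip}
    (hz : z ∈ BB e j) : ∃ ε > 0, ∀ q : Strip, z.2 ≤ q.2 → |q.1 - j| < ε →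
      (j < q.1 → q ∈ DD Up e j) ∧ (q.1 < j → q ∈ DD Up e (j - 1)) := by
  have hc : IsCompact ((fun y : II => (((j : ℝ), y) : Strip)) '' Ici z.2) :=
    (isClosed_Ici.isCompact).image (by fun_prop)
  obtain ⟨δ, hδ, hsub⟩ := hc.exists_thickening_subset_open (isOpen_U hX) (by
    rintro _ ⟨y, hy, rfl⟩
    exact BB_U hX he (j := j) ⟨rfl, lt_of_lt_of_le hz.2 hy⟩)
  have hU : ∀ q : Strip, z.2 ≤ q.2 → |q.1 - j| < δ → pr q ∈ Up := by
    intro q h1 h2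
    apply hsub
    rw [Metric.mem_thickening_iff]
    refine ⟨((j : ℝ), q.2), ⟨q.2, h1, rfl⟩, ?_⟩
    rw [Prod.dist_eq]
    simp [Real.dist_eq, h2]
  set ε := min δ (1 / 2) with hε
  have e0 : 0 < ε := lt_min hδ (by norm_num)
  have e1 : ε ≤ δ := min_le_left _ _
  have e2 : ε ≤ 1 / 2 := min_le_right _ _
  refine ⟨ε, e0, fun q hq1 hq2 => ⟨fun hq => ?_, fun hq => ?_⟩⟩
  · have hS : IsPreconnected (Ioo (j : ℝ) (j + ε) ×ˢ Ici z.2 : Set Strip) :=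
      isPreconnected_Ioo.prod (preconn_Ici z.2)
    refine DD_max hS ?_ ?_ ?_ (z := tp (j + ε / 2)) ?_ (tp_DD hX (by linarith) (by linarith)) ?_
    · rintro w ⟨⟨h1, h2⟩, h3⟩
      exact hU w h3 (abs_lt.mpr ⟨by linarith, by linarith⟩)
    · rintro w ⟨⟨h1, h2⟩, h3⟩ h; linarith [h.1]
    · rintro w ⟨⟨h1, h2⟩, h3⟩ h
      have := h.1; push_cast at this; linarith
    · exact ⟨⟨by simp; linarith, by simp; linarith⟩, z.2.2.2⟩
    · have := abs_lt.mp hq2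
      exact ⟨⟨hq, by linarith⟩, hq1⟩
  · have hS : IsPreconnected (Ioo (j - ε : ℝ) j ×ˢ Ici z.2 : Set Strip) :=
      isPreconnected_Ioo.prod (preconn_Ici z.2)
    refine DD_max hS ?_ ?_ ?_ (z := tp (j - ε / 2)) ?_
      (tp_DD hX (by push_cast; linarith) (by push_cast; linarith)) ?_
    · rintro w ⟨⟨h1, h2⟩, h3⟩
      exact hU w h3 (abs_lt.mpr ⟨by linarith, by linarith⟩)
    · rintro w ⟨⟨h1, h2⟩, h3⟩ h
      have := h.1; push_cast at this; linarith
    · rintro w ⟨⟨h1, h2⟩, h3⟩ h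
      have := h.1; push_cast at this; linarith
    · exact ⟨⟨by simp; linarith, by simp; linarith⟩, z.2.2.2⟩
    · have := abs_lt.mp hq2
      exact ⟨⟨by linarith, hq⟩, hq1⟩

lemma BB_closure {X Um Up : Set Ann} (hX : IsEAC X Um Up) {e : II} (he : Et X e) {j : ℤ}
    {z : Strip} (hz : z ∈ BB e j) : z ∈ closure (DD Up e j) ∧ z ∈ closure (DD Up e (j - 1)) := by
  obtain ⟨ε, hε, h⟩ := BB_rect hX he hz
  constructor
  · rw [Metric.mem_closure_iff]
    intro r hr
    have hm : 0 < min r ε := lt_min hr hε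
    have m1 := min_le_left r ε
    have m2 := min_le_right r ε
    refine ⟨(j + min r ε / 2, z.2), (h (j + min r ε / 2, z.2) le_rfl ?_).1 ?_, ?_⟩
    · simp only [add_sub_cancel_left]; rw [abs_of_pos (by linarith)]; linarith
    · simp only; linarith
    · rw [Prod.dist_eq, hz.1]
      simp [Real.dist_eq, hr]
      rw [abs_of_pos hm]; linarith
  · rw [Metric.mem_closure_iff]
    intro r hr
    have hm : 0 < min r ε := lt_min hr hε
    have m1 := min_le_left r ε
    have m2 := min_le_right r ε
    refine ⟨(j - min r ε / 2, z.2), (h (j - min r ε / 2, z.2) le_rfl ?_).2 ?_, ?_⟩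
    · simp only [sub_sub_cancel_left, abs_neg]; rw [abs_of_pos (by linarith)]; linarith
    · simp only; linarith
    · rw [Prod.dist_eq, hz.1]
      simp [Real.dist_eq, hr]
      rw [abs_of_pos hm]; linarith

lemma BB_nhd {X Um Up : Set Ann} (hX : IsEAC X Um Up) {e : II} (he : Et X e) {j : ℤ}
    {z : Strip} (hz : z ∈ BB e j) :
    ∀ᶠ q in 𝓝 z, q ∈ DD Up e j ∨ q ∈ DD Up e (j - 1) ∨ q ∈ BB e j := by
  have hlt : (e : ℝ) < z.2 := hz.2
  have hz1 := z.2.2.2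
  have he1 := e.2.1
  let y : II := ⟨((e : ℝ) + z.2) / 2, by linarith, by linarith⟩
  have hy1 : e < y := by show (e : ℝ) < ((e : ℝ) + z.2) / 2; linarith
  have hy2 : y < z.2 := by show ((e : ℝ) + z.2) / 2 < z.2; linarith
  obtain ⟨ε, hε, h⟩ := BB_rect hX he (z := ((j : ℝ), y)) (j := j) ⟨rfl, hy1⟩
  have o1 : ∀ᶠ q : Strip in 𝓝 z, y < q.2 :=
    (isOpen_lt continuous_const continuous_snd).mem_nhds hy2
  have o2 : ∀ᶠ q : Strip in 𝓝 z, |q.1 - j| < ε :=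
    (isOpen_lt (by fun_prop) continuous_const).mem_nhds (by simpa [hz.1] using hε)
  filter_upwards [o1, o2] with q h1 h2
  have hh := h q h1.le h2
  rcases lt_trichotomy q.1 j with h3 | h3 | h3
  · exact Or.inr (Or.inl (hh.2 h3))
  · exact Or.inr (Or.inr ⟨h3, hy1.trans h1⟩)
  · exact Or.inl (hh.1 h3)

lemma DD_shift {Up : Set Ann} {e : II} {j k : ℤ} {z : Strip} (hz : z ∈ DD Up e j) :
    shiftPt k z ∈ DD Up e (j + k) := by
  obtain ⟨w, hw, rfl⟩ := hz
  rw [shiftPt_shiftPt, add_comm]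
  exact mem_image_of_mem _ hw

lemma BB_shift {e : II} {j k : ℤ} {z : Strip} (hz : z ∈ BB e j) :
    shiftPt k z ∈ BB e (j + k) := ⟨by simp [hz.1], hz.2⟩

/-- The domains and the hairs cover. -/
lemma cover_U {X Um Up : Set Ann} (hX : IsEAC X Um Up) {e : II} (he : Et X e) {z : Strip}
    (hz : pr z ∈ Up) : ∃ j, z ∈ DD Up e j ∨ z ∈ BB e j := by
  set Ω : Set Strip := {z | ∃ j, z ∈ DD Up e j ∨ z ∈ BB e j} with hΩ
  have hΩo : IsOpen Ω := by
    rw [isOpen_iff_mem_nhds]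
    rintro w ⟨j, h | h⟩
    · filter_upwards [(DD_open hX he j).mem_nhds h] with q hq using ⟨j, Or.inl hq⟩
    · filter_upwards [BB_nhd hX he h] with q hq
      rcases hq with h | h | h
      · exact ⟨j, Or.inl h⟩
      · exact ⟨j - 1, Or.inl h⟩
      · exact ⟨j, Or.inr h⟩
  have hco : IsOpen (pr ⁻¹' Up \ Ω) := by
    rw [isOpen_iff_mem_nhds]
    rintro w ⟨h1, h2⟩
    have hwC : w ∉ CC e := fun h => by
      obtain ⟨j, hj⟩ := CC_U hX he h h1
      exact h2 ⟨j, Or.inr hj⟩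
    have hN : IsOpen (pr ⁻¹' Up \ CC e) := (isOpen_U hX).sdiff (isClosed_CC e)
    have hw : w ∈ pr ⁻¹' Up \ CC e := ⟨h1, hwC⟩
    filter_upwards [hN.connectedComponentIn.mem_nhds (mem_connectedComponentIn hw)] with q hq
    have hq' := connectedComponentIn_subset _ _ hq
    refine ⟨hq'.1, ?_⟩
    rintro ⟨j, h | h⟩
    · apply h2
      refine ⟨j, Or.inl ?_⟩
      refine DD_max isPreconnected_connectedComponentIn
        (fun x hx => (connectedComponentIn_subset _ _ hx).1) ?_ ?_ hq h
        (mem_connectedComponentIn hw)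
      · intro x hx hxB; exact (connectedComponentIn_subset _ _ hx).2 (BB_CC hxB)
      · intro x hx hxB; exact (connectedComponentIn_subset _ _ hx).2 (BB_CC hxB)
    · exact hq'.2 (BB_CC h)
  by_contra hcon
  have hUpc : IsPreconnected Up := by rw [hX.hUp]; exact isPreconnected_connectedComponentIn
  have hsh : ∀ k : ℤ, ∀ w, w ∈ Ω → shiftPt k w ∈ Ω := by
    rintro k w ⟨j, h | h⟩
    · exact ⟨j + k, Or.inl (DD_shift h)⟩
    · exact ⟨j + k, Or.inr (BB_shift h)⟩
  obtain ⟨p, hp, ⟨a, ha, hap⟩, ⟨b, hb, hbp⟩⟩ := hUpc (pr '' Ω) (pr '' (pr ⁻¹' Up \ Ω))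
    (isOpenMap_pr _ hΩo) (isOpenMap_pr _ hco) (by
      intro p hp
      obtain ⟨w, rfl⟩ := pr_surj p
      by_cases hw : w ∈ Ω
      · exact Or.inl ⟨w, hw, rfl⟩
      · exact Or.inr ⟨w, ⟨hp, hw⟩, rfl⟩)
    ⟨pr (tp (0 : ℤ)), tp_mem hX _, ⟨_, ⟨0, Or.inr (tp_BB hX he 0)⟩, rfl⟩⟩
    ⟨pr z, hz, ⟨z, ⟨hz, hcon⟩, rfl⟩⟩
  obtain ⟨k, hk⟩ := pr_eq_pr (hbp.trans hap.symm)
  exact hb.2 (hk ▸ hsh k a ha)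

lemma V_mem {Up : Set Ann} {e : II} {j : ℤ} {z : Strip} :
    z ∈ shiftSet j (Vset (pr ⁻¹' Up) e) ↔ pr z ∈ Up ∧ z ∈ closure (DD Up e j) := by
  rw [mem_shiftSet, Vset, mem_inter_iff, mem_preimage, pr_shift]
  refine and_congr Iff.rfl ?_
  have h1 : DD Up e j = (shiftPt (-j)) ⁻¹'
      (connectedComponentIn (pr ⁻¹' Up \ (betaP e ∪ shiftSet 1 (betaP e))) topSeg) := by
    ext w; exact mem_shiftSet
  let S : Strip ≃ₜ Strip :=
    { toFun := shiftPt (-j), invFun := shiftPt j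
      left_inv := fun w => by rw [shiftPt_shiftPt]; simp
      right_inv := fun w => by rw [shiftPt_shiftPt]; simp
      continuous_toFun := continuous_shiftPt _
      continuous_invFun := continuous_shiftPt _ }
  have h2 := S.preimage_closure
    (connectedComponentIn (pr ⁻¹' Up \ (betaP e ∪ shiftSet 1 (betaP e))) topSeg)
  rw [h1]
  exact Set.ext_iff.mp h2 z

lemma DD_V {Up : Set Ann} {e : II} {j : ℤ} {z : Strip} (h : z ∈ DD Up e j) :
    z ∈ shiftSet j (Vset (pr ⁻¹' Up) e) := V_mem.mpr ⟨DD_U h, subset_closure h⟩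

lemma V_cases {X Um Up : Set Ann} (hX : IsEAC X Um Up) {e : II} (he : Et X e) {j k : ℤ}
    {z : Strip} (h : z ∈ shiftSet k (Vset (pr ⁻¹' Up) e)) :
    (z ∈ DD Up e j → j = k) ∧ (z ∈ BB e j → j = k ∨ j = k + 1) := by
  obtain ⟨h1, h2⟩ := V_mem.mp h
  rw [mem_closure_iff_frequently] at h2
  constructor
  · intro hj
    obtain ⟨w, hw1, hw2⟩ := (h2.and_eventually ((DD_open hX he j).mem_nhds hj)).exists
    exact DD_disj hX he hw2 hw1
  · intro hj
    obtain ⟨w, hw1, hw2⟩ := (h2.and_eventually (BB_nhd hX he hj)).exists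
    rcases hw2 with h | h | h
    · exact Or.inl (DD_disj hX he h hw1)
    · right; have := DD_disj hX he h hw1; omega
    · exact (DD_BB hX he hw1 h).elim

/-- Segments of the strip. -/
noncomputable def seg (a b : Strip) (t : unitInterval) : Strip :=
  ((1 - t) * a.1 + t * b.1, ⟨(1 - t) * a.2 + t * b.2, by
    have := a.2.2.1; have := b.2.2.1; have := t.2.1; have := t.2.2; nlinarith, by
    have := a.2.2.2; have := b.2.2.2; have := t.2.1; have := t.2.2; nlinarith⟩)

lemma continuous_seg (a b : Strip) : Continuous (seg a b) := by unfold seg; fun_prop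

lemma seg_zero (a b : Strip) : seg a b 0 = a := by
  unfold seg; refine Prod.ext ?_ (Subtype.ext ?_) <;> simp

lemma seg_one (a b : Strip) : seg a b 1 = b := by
  unfold seg; refine Prod.ext ?_ (Subtype.ext ?_) <;> simp

lemma seg_inj {a b : Strip} (h : a ≠ b) : Function.Injective (seg a b) := by
  intro s t hst
  have h1 := congrArg (fun z : Strip => z.1) hst
  have h2 := congrArg (fun z : Strip => (z.2 : ℝ)) hst
  simp only [seg] at h1 h2
  by_contra hne
  have hne' : (s : ℝ) - t ≠ 0 := fun h => hne (Subtype.ext (sub_eq_zero.mp h))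
  apply h
  refine Prod.ext ?_ (Subtype.ext ?_)
  · apply mul_left_cancel₀ hne'; linarith
  · apply mul_left_cancel₀ hne'; linarith

lemma mem_box {p q : Strip} {r : ℝ} :
    q ∈ Metric.closedBall p r ↔ |q.1 - p.1| ≤ r ∧ |(q.2 : ℝ) - p.2| ≤ r := by
  rw [Metric.mem_closedBall, Prod.dist_eq, max_le_iff, Subtype.dist_eq, Real.dist_eq, Real.dist_eq]

lemma seg_box {p a b : Strip} {r : ℝ} (ha : a ∈ Metric.closedBall p r)
    (hb : b ∈ Metric.closedBall p r) (t : unitInterval) : seg a b t ∈ Metric.closedBall p r := by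
  rw [mem_box] at *
  have t0 := t.2.1
  have t1 := t.2.2
  simp only [abs_le] at *
  simp only [seg]
  obtain ⟨⟨a1, a2⟩, a3, a4⟩ := ha
  obtain ⟨⟨b1, b2⟩, b3, b4⟩ := hb
  refine ⟨⟨?_, ?_⟩, ?_, ?_⟩ <;> nlinarith

/-- clamp -/
noncomputable def pj (x : ℝ) : unitInterval := Set.projIcc (0 : ℝ) 1 zero_le_one x

lemma continuous_pj : Continuous pj := continuous_projIcc (h := zero_le_one)

lemma pj_val (t : unitInterval) : pj t = t := Set.projIcc_val zero_le_one t

lemma pj_of {x : ℝ} (h0 : 0 ≤ x) (h1 : x ≤ 1) : (pj x : ℝ) = x := by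
  unfold pj; rw [Set.projIcc_of_mem zero_le_one ⟨h0, h1⟩]

lemma uI_ne_one {t : unitInterval} : t ≠ 1 ↔ (t : ℝ) < 1 :=
  ⟨fun h => lt_of_le_of_ne t.2.2 (fun h' => h (Subtype.ext h')), fun h h' => by
    rw [h'] at h; exact lt_irrefl _ h⟩

/-- The tail of a path. -/
noncomputable def tail (γ : unitInterval → Strip) (s : unitInterval) (u : unitInterval) : Strip :=
  γ (pj (s + (1 - s) * u))

lemma tail_aux (s u : unitInterval) : (pj (s + (1 - s) * u) : ℝ) = s + (1 - s) * u := by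
  have := s.2.1; have := s.2.2; have := u.2.1; have := u.2.2
  exact pj_of (by nlinarith) (by nlinarith)

lemma tail_arc {W W' : Set Strip} {γ : unitInterval → Strip} {y : Strip} (h : IsArcTo W γ y)
    (s : unitInterval) (hs : s ≠ 1) (hW : ∀ t, s ≤ t → t ≠ 1 → γ t ∈ W') :
    IsArcTo W' (tail γ s) y := by
  have hs1 := uI_ne_one.mp hs
  refine ⟨?_, ?_, ?_, ?_⟩
  · exact h.1.comp (continuous_pj.comp (by fun_prop))
  · intro a b hab
    have := h.2.1 hab
    have := congrArg Subtype.val this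
    rw [tail_aux, tail_aux] at this
    apply Subtype.ext
    have h2 : (1 - (s : ℝ)) ≠ 0 := by linarith
    apply mul_left_cancel₀ h2
    linarith
  · intro t ht
    have ht1 := uI_ne_one.mp ht
    have := t.2.1
    apply hW
    · show (s : ℝ) ≤ _
      rw [tail_aux]; nlinarith
    · rw [uI_ne_one, tail_aux]; nlinarith
  · have : pj (s + (1 - s) * (1 : unitInterval)) = 1 := by
      apply Subtype.ext; rw [tail_aux]; simp
    unfold tail; rw [this]; exact h.2.2.2

lemma tail_zero (γ : unitInterval → Strip) (s : unitInterval) : tail γ s 0 = γ s := by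
  unfold tail; congr 1; apply Subtype.ext; rw [tail_aux]; simp

lemma Meet.symm {τ σ : unitInterval → Strip} (h : Meet τ σ) : Meet σ τ := by
  intro d hd
  obtain ⟨s, t, h1, h2, h3, h4, h5⟩ := h d hd
  exact ⟨t, s, h2, h1, h4, h3, h5.symm⟩

/-- Paths with the same tails meet the same paths. -/
lemma meet_tail {γ γ' τ : unitInterval → Strip} (h : Meet γ τ) (s t : unitInterval) (hs : s ≠ 1)
    (ht : t ≠ 1) (hst : ∀ u, tail γ' s u = tail γ t u) : Meet γ' τ := by
  intro d hd
  have hs1 := uI_ne_one.mp hs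
  have ht1 := uI_ne_one.mp ht
  have hpos : 0 < 1 - (t : ℝ) := by linarith
  have hpos' : 0 < 1 - (s : ℝ) := by linarith
  have hd2 : t + (1 - t) * max 0 ((d - s) / (1 - s)) < (1 : ℝ) := by
    have : max 0 ((d - s) / (1 - s)) < (1 : ℝ) := by
      apply max_lt one_pos; rw [div_lt_one hpos']; linarith
    nlinarith
  obtain ⟨a, b, ha, hb, ha1, hb1, hab⟩ := h (max d (t + (1 - t) * max 0 ((d - s) / (1 - s))))
    (max_lt hd hd2)
  have ha' := (max_lt_iff.mp ha).2
  have ha1' := uI_ne_one.mp ha1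
  set m := max 0 ((d - s) / (1 - s)) with hm
  have hm0 : 0 ≤ m := le_max_left _ _
  have hm1 : (d - s) / (1 - s) ≤ m := le_max_right _ _
  rw [div_le_iff₀ hpos'] at hm1
  have hu0 : m < (a - t) / (1 - t) := by rw [lt_div_iff₀ hpos]; linarith
  have hu1 : ((a : ℝ) - t) / (1 - t) < 1 := by rw [div_lt_one hpos]; linarith
  set u : unitInterval := ⟨(a - t) / (1 - t), by linarith, hu1.le⟩ with hu
  have huv : (u : ℝ) = (a - t) / (1 - t) := rfl
  have h1 : pj (t + (1 - t) * u) = a := by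
    apply Subtype.ext; rw [tail_aux, huv]; field_simp; ring
  refine ⟨pj (s + (1 - s) * u), b, ?_, (max_lt_iff.mp hb).1, ?_, hb1, ?_⟩
  · rw [tail_aux, huv]; nlinarith
  · rw [uI_ne_one, tail_aux, huv]; nlinarith
  · have := hst u
    unfold tail at this
    rw [this, h1, hab]

lemma tail_of_zero (γ : unitInterval → Strip) (u : unitInterval) : tail γ 0 u = γ u := by
  unfold tail; congr 1; apply Subtype.ext; rw [tail_aux]; simp

/-- Prefixing by a segment. -/
noncomputable def pre (a : Strip) (γ : unitInterval → Strip) (u : unitInterval) : Strip :=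
  if (u : ℝ) ≤ 1 / 2 then seg a (γ 0) (pj (2 * u)) else γ (pj (2 * u - 1))

lemma pre_op {W : Set Strip} {γ : unitInterval → Strip} {y : Strip} (h : IsArcTo W γ y) {p b : Strip}
    {r : ℝ} (hC : Metric.closedBall p r ⊆ W) (hb : b ∈ Metric.closedBall p r)
    (h0 : γ 0 ∈ Metric.closedBall p r) (hlast : ∀ t, γ t ∈ Metric.closedBall p r → t = 0)
    (hne : b ≠ γ 0) {τ : unitInterval → Strip} (hM : Meet γ τ) :
    IsArcTo W (pre b γ) y ∧ pre b γ 0 = b ∧ Meet (pre b γ) τ := by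
  have z0 : pre b γ 0 = b := by
    unfold pre; simp only [Set.Icc.coe_zero]
    rw [if_pos (by norm_num)]
    have : pj (2 * (0 : ℝ)) = 0 := Subtype.ext (by rw [pj_of] <;> simp)
    rw [this, seg_zero]
  refine ⟨⟨?_, ?_, ?_, ?_⟩, z0, ?_⟩
  · unfold pre
    refine Continuous.if_le ?_ ?_ (by fun_prop) continuous_const ?_
    · exact (continuous_seg _ _).comp (continuous_pj.comp (by fun_prop))
    · exact h.1.comp (continuous_pj.comp (by fun_prop))
    · intro u hu
      have e1 : pj (2 * (u : ℝ)) = 1 := Subtype.ext (by rw [hu, pj_of] <;> norm_num)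
      have e2 : pj (2 * (u : ℝ) - 1) = 0 := Subtype.ext (by rw [hu, pj_of] <;> norm_num)
      rw [e1, e2, seg_one]
  · have cross : ∀ u v : unitInterval, (u : ℝ) ≤ 1 / 2 → ¬ (v : ℝ) ≤ 1 / 2 →
        seg b (γ 0) (pj (2 * u)) = γ (pj (2 * v - 1)) → False := by
      intro u v hu hv heq
      have hm := seg_box hb h0 (pj (2 * u))
      rw [heq] at hm
      have := congrArg Subtype.val (hlast _ hm)
      rw [pj_of (by linarith) (by linarith [v.2.2])] at this
      simp at this; linarith
    intro u v huv
    unfold pre at huv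
    split_ifs at huv with h1 h2 h2
    · have := congrArg Subtype.val (seg_inj hne huv)
      rw [pj_of (by linarith [u.2.1]) (by linarith), pj_of (by linarith [v.2.1]) (by linarith)] at this
      apply Subtype.ext; linarith
    · exact (cross u v h1 h2 huv).elim
    · exact (cross v u h2 h1 huv.symm).elim
    · push Not at h1 h2
      have := congrArg Subtype.val (h.2.1 huv)
      rw [pj_of (by linarith) (by linarith [u.2.2]), pj_of (by linarith) (by linarith [v.2.2])] at this
      apply Subtype.ext; linarith
  · intro u hu
    have hu1 := uI_ne_one.mp hu
    unfold pre
    split_ifs with h1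
    · exact hC (seg_box hb h0 _)
    · push Not at h1
      apply h.2.2.1
      rw [uI_ne_one, pj_of (by linarith) (by linarith)]; linarith
  · unfold pre
    rw [if_neg (by norm_num)]
    have : pj (2 * ((1 : unitInterval) : ℝ) - 1) = 1 := Subtype.ext (by rw [pj_of] <;> norm_num)
    rw [this]; exact h.2.2.2
  · have hh : ((⟨1 / 2, by norm_num, by norm_num⟩ : unitInterval) : ℝ) = 1 / 2 := rfl
    refine meet_tail hM ⟨1 / 2, by norm_num, by norm_num⟩ 0 (by rw [uI_ne_one, hh]; norm_num)
      (by rw [uI_ne_one]; norm_num) ?_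
    intro u
    rw [tail_of_zero]
    unfold tail pre
    rw [tail_aux, hh]
    split_ifs with h1
    · have hu : u = 0 := Subtype.ext (le_antisymm (by simp only [Set.Icc.coe_zero]; linarith) u.2.1)
      subst hu
      have : pj (2 * (1 / 2 + (1 - 1 / 2) * ((0 : unitInterval) : ℝ))) = 1 :=
        Subtype.ext (by rw [pj_of] <;> norm_num)
      rw [this, seg_one]
    · congr 1
      rw [← pj_val u]
      congr 1
      rw [pj_val]; ring

/-- Moving the origin of an arc inside a box. -/
lemma arc_box {W : Set Strip} {γ : unitInterval → Strip} {y : Strip} (h : IsArcTo W γ y) {p b : Strip}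
    (hy : y ∉ W) {r : ℝ} (hC : Metric.closedBall p r ⊆ W) (hb : b ∈ Metric.closedBall p r)
    (h0 : γ 0 ∈ Metric.closedBall p r) {τ : unitInterval → Strip} (hM : Meet γ τ) :
    ∃ γ', IsArcTo W γ' y ∧ γ' 0 = b ∧ Meet γ' τ := by
  have hcl : IsClosed {t | γ t ∈ Metric.closedBall p r} := Metric.isClosed_closedBall.preimage h.1
  obtain ⟨s, hs, hmax⟩ := hcl.isCompact.exists_isGreatest ⟨0, h0⟩
  have hs1 : s ≠ 1 := by
    rintro rfl
    exact hy (hC (h.2.2.2 ▸ hs))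
  have ha : IsArcTo W (tail γ s) y := tail_arc h s hs1 (fun t _ ht => h.2.2.1 t ht)
  have hMt : Meet (tail γ s) τ :=
    meet_tail hM 0 s (by rw [uI_ne_one]; norm_num) hs1 (fun u => tail_of_zero _ u)
  by_cases hne : b = γ s
  · exact ⟨tail γ s, ha, by rw [tail_zero, hne], hMt⟩
  · obtain ⟨h1, h2, h3⟩ := pre_op ha hC hb (by rw [tail_zero]; exact hs) (by
      intro t ht
      have := hmax ht
      have hle : (pj (s + (1 - s) * t) : ℝ) ≤ s := this
      rw [tail_aux] at hle
      have hs' := uI_ne_one.mp hs1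
      apply Subtype.ext
      apply le_antisymm _ t.2.1
      show (t : ℝ) ≤ 0
      nlinarith) (by rw [tail_zero]; exact hne) hMt
    exact ⟨_, h1, h2, h3⟩

/-- Arc lemma. -/
lemma arc_move {W : Set Strip} (hWo : IsOpen W) (hWc : IsPreconnected W) {γ : unitInterval → Strip}
    {y : Strip} (h : IsArcTo W γ y) (hy : y ∉ W) {τ : unitInterval → Strip} (hM : Meet γ τ) {b : Strip}
    (hb : b ∈ W) : ∃ γ', IsArcTo W γ' y ∧ γ' 0 = b ∧ Meet γ' τ := by
  set S : Set Strip := {b | b ∈ W ∧ ∃ γ', IsArcTo W γ' y ∧ γ' 0 = b ∧ Meet γ' τ} with hS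
  have box : ∀ z ∈ W, ∃ r > 0, Metric.closedBall z r ⊆ W := fun z hz =>
    Metric.nhds_basis_closedBall.mem_iff.mp (hWo.mem_nhds hz)
  have hSo : IsOpen S := by
    rw [isOpen_iff_mem_nhds]
    rintro z ⟨hz, γ', h1, h2, h3⟩
    obtain ⟨r, hr, hC⟩ := box z hz
    filter_upwards [Metric.closedBall_mem_nhds z hr] with q hq
    refine ⟨hC hq, arc_box h1 hy hC hq ?_ h3⟩
    rw [h2]; exact Metric.mem_closedBall_self hr.le
  have hco : IsOpen (W \ S) := by
    rw [isOpen_iff_mem_nhds]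
    rintro z ⟨hz, hzS⟩
    obtain ⟨r, hr, hC⟩ := box z hz
    filter_upwards [Metric.closedBall_mem_nhds z hr] with q hq
    refine ⟨hC hq, ?_⟩
    rintro ⟨-, γ', h1, h2, h3⟩
    exact hzS ⟨hz, arc_box h1 hy hC (Metric.mem_closedBall_self hr.le) (by rw [h2]; exact hq) h3⟩
  by_contra hcon
  have h0 : γ 0 ∈ W := h.2.2.1 0 (by rw [uI_ne_one]; norm_num)
  obtain ⟨q, -, hq1, hq2⟩ := hWc S (W \ S) hSo hco
    (fun z hz => by
      by_cases hzS : z ∈ S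
      · exact Or.inl hzS
      · exact Or.inr ⟨hz, hzS⟩) ⟨γ 0, h0, h0, γ, h, rfl, hM⟩
    ⟨b, hb, hb, fun hbS => hcon hbS.2⟩
  exact hq2.2 hq1

/-- Tail in a domain. -/
def KA (Up : Set Ann) (e : II) (j : ℤ) (τ : unitInterval → Strip) : Prop :=
  ∃ s : unitInterval, s ≠ 1 ∧ ∀ t, s ≤ t → t ≠ 1 → τ t ∈ DD Up e j

/-- Oscillating about a hair. -/
def KB (e : II) (j : ℤ) (τ : unitInterval → Strip) : Prop :=
  τ 1 = ((j : ℝ), e) ∧ ∀ d : ℝ, d < 1 → ∃ t : unitInterval, d < t ∧ t ≠ 1 ∧ τ t ∈ BB e j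

/-- The key of an access path. -/
def Key (Up : Set Ann) (e : II) (τ : unitInterval → Strip) (κ : ℤ) : Prop :=
  (∃ j, κ = 2 * j + 1 ∧ KA Up e j τ) ∨ (∃ j, κ = 2 * j ∧ KB e j τ)

/-- The cells of the decomposition. -/
def Cell (Up : Set Ann) (e : II) (κ : ℤ) : Set Strip :=
  {z | (∃ j, κ = 2 * j + 1 ∧ z ∈ DD Up e j) ∨ (∃ j, κ = 2 * j ∧ z ∈ BB e j)}

lemma cell_disj {X Um Up : Set Ann} (hX : IsEAC X Um Up) {e : II} (he : Et X e) {κ κ' : ℤ}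
    (h : κ ≠ κ') : Disjoint (Cell Up e κ) (Cell Up e κ') := by
  rw [Set.disjoint_left]
  rintro z (⟨j, rfl, h1⟩ | ⟨j, rfl, h1⟩) (⟨i, rfl, h2⟩ | ⟨i, rfl, h2⟩)
  · exact h (by rw [DD_disj hX he h1 h2])
  · exact DD_BB hX he h1 h2
  · exact DD_BB hX he h2 h1
  · refine BB_disj (fun hij => h ?_) h1 h2
    rw [hij]

lemma exists_key {X Um Up : Set Ann} (hX : IsEAC X Um Up) {e : II} (he : Et X e)
    {τ : unitInterval → Strip} (hc : Continuous τ) (hU : ∀ t, t ≠ 1 → pr (τ t) ∈ Up)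
    (h1 : pr (τ 1) ∈ X) : ∃ κ, Key Up e τ κ := by
  by_cases hcase : ∃ s : unitInterval, s ≠ 1 ∧ ∀ t, s ≤ t → t ≠ 1 → ∀ j, τ t ∉ BB e j
  · obtain ⟨s, hs, hB⟩ := hcase
    obtain ⟨j, hj⟩ := cover_U hX he (hU s hs)
    have hj' : τ s ∈ DD Up e j := hj.resolve_right (hB s le_rfl hs j)
    refine ⟨2 * j + 1, Or.inl ⟨j, rfl, s, hs, ?_⟩⟩
    have hs1 := uI_ne_one.mp hs
    have hpre : IsPreconnected ((fun x : ℝ => τ (pj x)) '' Ico (s : ℝ) 1) :=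
      isPreconnected_Ico.image _ (hc.comp continuous_pj).continuousOn
    have hpt : ∀ x ∈ Ico (s : ℝ) 1, s ≤ pj x ∧ pj x ≠ 1 := by
      intro x hx
      have := pj_of (s.2.1.trans hx.1) hx.2.le
      refine ⟨?_, ?_⟩
      · show (s : ℝ) ≤ pj x
        rw [this]; exact hx.1
      · rw [uI_ne_one, this]; exact hx.2
    have hsub : (fun x : ℝ => τ (pj x)) '' Ico (s : ℝ) 1 ⊆ DD Up e j := by
      refine DD_max hpre ?_ ?_ ?_ (z := τ s) ⟨s, ⟨le_rfl, hs1⟩, by simp only [pj_val]⟩ hj'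
      · rintro _ ⟨x, hx, rfl⟩; exact hU _ (hpt x hx).2
      · rintro _ ⟨x, hx, rfl⟩; exact hB _ (hpt x hx).1 (hpt x hx).2 _
      · rintro _ ⟨x, hx, rfl⟩; exact hB _ (hpt x hx).1 (hpt x hx).2 _
    intro t hst ht
    exact hsub ⟨t, ⟨hst, uI_ne_one.mp ht⟩, by simp only [pj_val]⟩
  · push Not at hcase
    have hcl : τ 1 ∈ CC e := by
      rw [← (isClosed_CC e).closure_eq, Metric.mem_closure_iff]
      intro r hr
      obtain ⟨δ, hδ, hd⟩ := Metric.continuous_iff.mp hc 1 r hr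
      have hm : 0 ≤ 1 - min δ 1 / 2 ∧ 1 - min δ 1 / 2 < 1 ∧ 1 - δ < 1 - min δ 1 / 2 := by
        have := lt_min hδ one_pos
        have := min_le_left δ 1
        have := min_le_right δ 1
        refine ⟨by linarith, by linarith, by linarith⟩
      obtain ⟨t, ht1, ht2, j, hj⟩ := hcase (pj (1 - min δ 1 / 2))
        (by rw [uI_ne_one, pj_of hm.1 hm.2.1.le]; exact hm.2.1)
      refine ⟨τ t, BB_CC hj, ?_⟩
      rw [dist_comm]
      apply hd
      have : (pj (1 - min δ 1 / 2) : ℝ) ≤ t := ht1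
      rw [pj_of hm.1 hm.2.1.le] at this
      have h2 := t.2.2
      rw [Subtype.dist_eq, Real.dist_eq, abs_lt, Set.Icc.coe_one]
      constructor <;> linarith [hm.2.2]
    obtain ⟨⟨j, hj⟩, h2⟩ := hcl
    have h3 := Et_le he j _ h1 hj.symm
    refine ⟨2 * j, Or.inr ⟨j, rfl, Prod.ext hj.symm (le_antisymm h3 h2), ?_⟩⟩
    intro d hd
    have hev : ∀ᶠ t in 𝓝 (1 : unitInterval), |(τ t).1 - j| < 1 :=
      (isOpen_lt (by fun_prop) continuous_const).mem_nhds (by simp [hj])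
    obtain ⟨δ, hδ, hd'⟩ := Metric.eventually_nhds_iff.mp hev
    set c := max (max 0 ((1 + d) / 2)) (1 - δ / 2) with hcdef
    have c0 : 0 ≤ c := (le_max_left _ _).trans (le_max_left _ _)
    have c1 : (1 + d) / 2 ≤ c := (le_max_right _ _).trans (le_max_left _ _)
    have c2 : 1 - δ / 2 ≤ c := le_max_right _ _
    have c3 : c < 1 := max_lt (max_lt one_pos (by linarith)) (by linarith)
    obtain ⟨t, ht1, ht2, i, hi⟩ := hcase (pj c) (by rw [uI_ne_one, pj_of c0 c3.le]; exact c3)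
    have h5 : (pj c : ℝ) ≤ t := ht1
    rw [pj_of c0 c3.le] at h5
    refine ⟨t, by linarith, ht2, ?_⟩
    have h6 := hd' (y := t) (by
      rw [Subtype.dist_eq, Real.dist_eq, abs_lt, Set.Icc.coe_one]
      have := t.2.2
      constructor <;> linarith)
    rw [hi.1] at h6
    have h7 : |i - j| < 1 := by exact_mod_cast h6
    have h8 : i = j := by rw [Int.abs_lt_one_iff] at h7; omega
    rw [← h8]; exact hi

/-- Representatives. -/
lemma exists_rep {X Um Up : Set Ann} (hX : IsEAC X Um Up) {e : II} (he : Et X e)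
    {τ : unitInterval → Strip} {y : Strip} (hτ : IsArcTo (pr ⁻¹' Up) τ y) (hy : pr y ∈ X) {κ : ℤ}
    (hk : Key Up e τ κ) : ∃ τ', IsArcTo (pr ⁻¹' Up) τ' y ∧ τ' 0 = tp (κ / 2) ∧ Meet τ' τ ∧
      ∀ t, t ≠ 1 → τ' t ∈ Cell Up e κ := by
  have h01 : (0 : unitInterval) ≠ 1 := by rw [uI_ne_one]; norm_num
  rcases hk with ⟨j, rfl, s, hs, hD⟩ | ⟨j, rfl, hj1, hj2⟩
  · have hta := tail_arc hτ s hs hD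
    have hMM : Meet (tail τ s) (tail τ s) := by
      intro d hd
      have hd' : max 0 ((1 + d) / 2) < 1 := max_lt one_pos (by linarith)
      have h1 : d < pj (max 0 ((1 + d) / 2)) := by
        rw [pj_of (le_max_left _ _) hd'.le]
        exact lt_of_lt_of_le (by linarith) (le_max_right _ _)
      have h2 : pj (max 0 ((1 + d) / 2)) ≠ 1 := by
        rw [uI_ne_one, pj_of (le_max_left _ _) hd'.le]; exact hd'
      exact ⟨_, _, h1, h1, h2, h2, rfl⟩
    have hM : Meet (tail τ s) τ :=
      (meet_tail hMM s 0 hs h01 (fun u => (tail_of_zero (tail τ s) u).symm)).symm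
    have hyD : y ∉ DD Up e j := fun h => U_ne_X hX (DD_U h) hy rfl
    obtain ⟨γ, g1, g2, g3⟩ := arc_move (DD_open hX he j) (DD_conn hX e j).isPreconnected hta hyD hM
      (b := tp ((2 * j + 1 : ℤ) / 2)) (tp_DD hX (by push_cast; linarith) (by push_cast; linarith))
    exact ⟨γ, ⟨g1.1, g1.2.1, fun t ht => DD_U (g1.2.2.1 t ht), g1.2.2.2⟩, g2, g3,
      fun t ht => Or.inl ⟨j, rfl, g1.2.2.1 t ht⟩⟩
  · have hyj : y = ((j : ℝ), e) := by rw [← hτ.2.2.2, hj1]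
    refine ⟨bt e j, hyj ▸ bt_arc hX he j, ?_, ?_, fun t ht =>
      Or.inr ⟨j, rfl, bt_mem (e_lt hX he) j t ht⟩⟩
    · rw [bt_zero]; congr 1; push_cast; ring
    · intro d hd
      have hel := e_lt hX he
      have hev : ∀ᶠ t in 𝓝 (1 : unitInterval), ((τ t).2 : ℝ) < 1 - d * (1 - e) := by
        have := hτ.1
        refine (isOpen_lt (by fun_prop) continuous_const).mem_nhds ?_
        show ((τ 1).2 : ℝ) < 1 - d * (1 - e)
        rw [hj1]; simp only; nlinarith
      obtain ⟨δ, hδ, hd'⟩ := Metric.eventually_nhds_iff.mp hev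
      obtain ⟨t, ht1, ht2, ht3⟩ := hj2 (max d (1 - δ)) (max_lt hd (by linarith))
      have h6 := hd' (y := t) (by
        rw [Subtype.dist_eq, Real.dist_eq, abs_lt, Set.Icc.coe_one]
        have := t.2.2
        have := (max_lt_iff.mp ht1).2
        constructor <;> linarith)
      obtain ⟨s, hs1, hs2⟩ := bt_surj ht3
      refine ⟨s, t, ?_, (max_lt_iff.mp ht1).1, hs1, ht2, hs2⟩
      rw [← hs2] at h6
      simp only [bt] at h6
      nlinarith

lemma arcs_disj {X Um Up : Set Ann} (hX : IsEAC X Um Up) {γ δ : unitInterval → Strip} {y z : Strip}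
    (hγ : IsArcTo (pr ⁻¹' Up) γ y) (hδ : IsArcTo (pr ⁻¹' Up) δ z) (hy : pr y ∈ X) (hz : pr z ∈ X)
    (hyz : y ≠ z) {A B : Set Strip} (hAB : Disjoint A B) (hA : ∀ t, t ≠ 1 → γ t ∈ A)
    (hB : ∀ t, t ≠ 1 → δ t ∈ B) : ∀ s t, γ s ≠ δ t := by
  intro s t h
  by_cases hs : s = 1
  · rw [hs, hγ.2.2.2] at h
    by_cases ht : t = 1
    · rw [ht, hδ.2.2.2] at h; exact hyz h
    · exact U_ne_X hX (hδ.2.2.1 t ht) hy h.symm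
  · by_cases ht : t = 1
    · rw [ht, hδ.2.2.2] at h
      exact U_ne_X hX (hγ.2.2.1 s hs) hz h
    · exact Set.disjoint_left.mp hAB (hA s hs) (h ▸ hB t ht)

lemma prec_of {X Um Up : Set Ann} (hX : IsEAC X Um Up) {e : II} (he : Et X e)
    {γ δ : unitInterval → Strip} {y z : Strip}
    (hγ : IsArcTo (pr ⁻¹' Up) γ y) (hδ : IsArcTo (pr ⁻¹' Up) δ z) (hy : pr y ∈ X) (hz : pr z ∈ X)
    (hyz : y ≠ z) {κ κ' : ℤ} (hlt : κ < κ') (hA : ∀ t, t ≠ 1 → γ t ∈ Cell Up e κ)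
    (hB : ∀ t, t ≠ 1 → δ t ∈ Cell Up e κ') (h0 : γ 0 = tp (κ / 2)) (h0' : δ 0 = tp (κ' / 2)) :
    PrecB 1 (pr ⁻¹' Up) y z := by
  refine ⟨γ, δ, hγ, hδ, by rw [h0]; rfl, by rw [h0']; rfl, ?_, ?_⟩
  · rw [Set.disjoint_left]
    rintro _ ⟨s, rfl⟩ ⟨t, ht⟩
    exact arcs_disj hX hγ hδ hy hz hyz (cell_disj hX he hlt.ne) hA hB s t ht.symm
  · rw [h0, h0', tp_fst, tp_fst]
    have : (κ : ℝ) < κ' := by exact_mod_cast hlt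
    linarith

lemma bt_start (e : II) (j : ℤ) : bt e j 0 = tp ((2 * j : ℤ) / 2) := by
  rw [bt_zero]; congr 1; push_cast; ring

lemma bt_cell {X Um Up : Set Ann} (hX : IsEAC X Um Up) {e : II} (he : Et X e) (j : ℤ)
    (t : unitInterval) (ht : t ≠ 1) : bt e j t ∈ Cell Up e (2 * j) :=
  Or.inr ⟨j, rfl, bt_mem (e_lt hX he) j t ht⟩

lemma shift_x0 (e : II) (j : ℤ) : shiftPt j ((0 : ℝ), e) = ((j : ℝ), e) := by
  unfold shiftPt; simp

lemma idx_B {X Um Up : Set Ann} (hX : IsEAC X Um Up) {e : II} (he : Et X e) (j : ℤ) :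
    AccIdxB 1 (pr ⁻¹' Up) ((j : ℝ), e) ((0 : ℝ), e) j := by
  refine ⟨Or.inl (shift_x0 e j), ?_⟩
  rw [shift_x0]
  refine prec_of hX he (bt_arc hX he j) (bt_arc hX he (j + 1)) (Et_X he j) (Et_X he (j + 1)) ?_
    (κ := 2 * j) (κ' := 2 * (j + 1)) (by omega) (bt_cell hX he j) (bt_cell hX he (j + 1))
    (bt_start e j) (bt_start e (j + 1))
  intro h
  have := congrArg Prod.fst h
  simp at this

lemma exists_idx {X Um Up : Set Ann} (hX : IsEAC X Um Up) {e : II} (he : Et X e)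
    {τ : unitInterval → Strip} {y : Strip} (hτ : IsArcTo (pr ⁻¹' Up) τ y) (hy : pr y ∈ X) {κ : ℤ}
    (hk : Key Up e τ κ) : ∃ k : ℤ, κ ≤ 2 * k + 1 ∧ AccIdxB 1 (pr ⁻¹' Up) y ((0 : ℝ), e) k := by
  obtain ⟨τ', r1, r2, r3, r4⟩ := exists_rep hX he hτ hy hk
  rcases hk with ⟨j, rfl, -⟩ | ⟨j, rfl, hj1, hj2⟩
  · by_cases hj : y = (((j + 1 : ℤ) : ℝ), e)
    · rw [hj]; exact ⟨j + 1, by omega, idx_B hX he (j + 1)⟩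
    · refine ⟨j, by omega, ?_, ?_⟩
      · rw [shift_x0]
        by_cases hj' : ((j : ℝ), e) = y
        · exact Or.inl hj'
        · exact Or.inr (prec_of hX he (bt_arc hX he j) r1 (Et_X he j) hy hj'
            (κ := 2 * j) (by omega) (bt_cell hX he j) r4 (bt_start e j) r2)
      · rw [shift_x0]
        exact prec_of hX he r1 (bt_arc hX he (j + 1)) hy (Et_X he (j + 1)) hj
            (κ' := 2 * (j + 1)) (by omega) r4 (bt_cell hX he (j + 1)) r2 (bt_start e (j + 1))
  · have hyj : y = ((j : ℝ), e) := by rw [← hτ.2.2.2, hj1]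
    rw [hyj]; exact ⟨j, by omega, idx_B hX he j⟩

/-- The embedding of the annulus in the plane. -/
noncomputable def ea (p : Ann) : ℂ := (Real.exp (p.2 : ℝ) : ℂ) * (AddCircle.toCircle p.1 : ℂ)

lemma continuous_ea : Continuous ea := by
  unfold ea
  have h : Continuous (AddCircle.toCircle : AddCircle (1 : ℝ) → Circle) :=
    AddCircle.continuous_toCircle
  have h1 : Continuous fun p : Ann => (AddCircle.toCircle p.1 : ℂ) :=
    continuous_subtype_val.comp (h.comp continuous_fst)
  have h2 : Continuous fun p : Ann => (Real.exp (p.2 : ℝ) : ℂ) := by fun_prop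
  exact h2.mul h1

lemma ea_inj : Function.Injective ea := by
  intro p q h
  have hn := congrArg norm h
  unfold ea at hn h
  rw [norm_mul, norm_mul, Circle.norm_coe, Circle.norm_coe, mul_one, mul_one, Complex.norm_real,
    Complex.norm_real, Real.norm_of_nonneg (Real.exp_pos _).le,
    Real.norm_of_nonneg (Real.exp_pos _).le] at hn
  have h2 : p.2 = q.2 := Subtype.ext (Real.exp_injective hn)
  rw [h2] at h
  have h3 := mul_left_cancel₀ (by exact_mod_cast (Real.exp_pos _).ne') h
  exact Prod.ext (AddCircle.injective_toCircle one_ne_zero (Subtype.ext h3)) h2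

lemma ea_pr (z : Strip) : ea (pr z) = Complex.exp ((z.2 : ℝ) + 2 * Real.pi * z.1 * Complex.I) := by
  unfold ea pr
  simp only [AddCircle.toCircle_apply_mk, Circle.coe_exp]
  rw [Complex.exp_add, Complex.ofReal_exp]
  congr 2
  push_cast
  ring

lemma ea_ne (p : Ann) : ea p ≠ 0 := by
  obtain ⟨z, rfl⟩ := pr_surj p
  rw [ea_pr]; exact Complex.exp_ne_zero _

/-- Polar coordinates in a half disc. -/
noncomputable def Pol (a : ℝ) (v : ℝ × ℝ) : Strip :=
  (a + Real.exp (min v.1 0) / 2 * Real.cos (max 0 (min v.2 Real.pi)),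
    Set.projIcc (-1 : ℝ) 1 (by norm_num)
      (1 - Real.exp (min v.1 0) / 2 * Real.sin (max 0 (min v.2 Real.pi))))

lemma continuous_Pol (a : ℝ) : Continuous (Pol a) := by
  unfold Pol
  refine Continuous.prodMk (by fun_prop) (continuous_projIcc.comp (by fun_prop))

/-- The local coordinate near a top point. -/
noncomputable def wc (a : ℝ) (z : Strip) : ℂ := ⟨z.1 - a, 1 - z.2⟩

lemma continuous_wc (a : ℝ) : Continuous (wc a) := by
  have : wc a = fun z : Strip => ((z.1 - a : ℝ) : ℂ) + ((1 - z.2 : ℝ) : ℂ) * Complex.I := by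
    funext z; apply Complex.ext <;> simp [wc]
  rw [this]; fun_prop

lemma wc_Pol (a : ℝ) (v : ℝ × ℝ) : wc a (Pol a v) = (Real.exp (min v.1 0) / 2 : ℝ) *
    Complex.exp ((max 0 (min v.2 Real.pi) : ℝ) * Complex.I) := by
  set r := Real.exp (min v.1 0) / 2 with hr
  set θ := max 0 (min v.2 Real.pi) with hθ
  have hr0 : 0 < r := by rw [hr]; positivity
  have hr1 : r ≤ 1 / 2 := by
    have : Real.exp (min v.1 0) ≤ 1 := Real.exp_le_one_iff.mpr (min_le_right _ _)
    rw [hr]; linarith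
  have hs : 0 ≤ Real.sin θ := Real.sin_nonneg_of_nonneg_of_le_pi (le_max_left _ _)
    (max_le Real.pi_pos.le (min_le_right _ _))
  have hs1 := Real.sin_le_one θ
  have hm : 1 - r * Real.sin θ ∈ Icc (-1 : ℝ) 1 := ⟨by nlinarith, by nlinarith⟩
  have h2 : ((Pol a v).2 : ℝ) = 1 - r * Real.sin θ := by
    unfold Pol; simp only [← hr, ← hθ]
    rw [Set.projIcc_of_mem (by norm_num) hm]
  have h1 : (Pol a v).1 = a + r * Real.cos θ := rfl
  unfold wc
  rw [h1, h2, Complex.exp_mul_I, ← Complex.ofReal_cos, ← Complex.ofReal_sin]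
  apply Complex.ext
  · simp [-Complex.ofReal_cos, -Complex.ofReal_sin]
  · simp [-Complex.ofReal_cos, -Complex.ofReal_sin]

lemma Pol_inv (a : ℝ) (z : Strip) (h0 : wc a z ≠ 0) (h1 : ‖wc a z‖ ≤ 1 / 2) :
    Pol a ((Complex.log (wc a z)).re + Real.log 2, (Complex.log (wc a z)).im) = z := by
  have hn : 0 < ‖wc a z‖ := norm_pos_iff.mpr h0
  have e1 : (Complex.log (wc a z)).re + Real.log 2 = Real.log (‖wc a z‖ * 2) := by
    rw [Complex.log_re, Real.log_mul hn.ne' (by norm_num)]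
  have e2 : min (Real.log (‖wc a z‖ * 2)) 0 = Real.log (‖wc a z‖ * 2) :=
    min_eq_left (Real.log_nonpos (by positivity) (by linarith))
  have him : 0 ≤ (wc a z).im := by
    have := z.2.2.2; simp only [wc]; linarith
  have e3 : max 0 (min (Complex.arg (wc a z)) Real.pi) = Complex.arg (wc a z) := by
    rw [min_eq_left (Complex.arg_le_pi _), max_eq_right (Complex.arg_nonneg_iff.mpr him)]
  have key := wc_Pol a ((Complex.log (wc a z)).re + Real.log 2, (Complex.log (wc a z)).im)
  simp only at key
  rw [e1, e2, Complex.log_im, e3, Real.exp_log (by positivity), mul_div_cancel_right₀ _ (by norm_num),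
    Complex.norm_mul_exp_arg_mul_I] at key
  rw [e1, Complex.log_im]
  have k1 := congrArg Complex.re key
  have k2 := congrArg Complex.im key
  simp only [wc] at k1 k2
  refine Prod.ext ?_ (Subtype.ext ?_)
  · simp only [wc]; linarith
  · simp only [wc]; linarith

/-- Homeomorphisms of the annulus preserve the boundary. -/
lemma bdry (H : Ann ≃ₜ Ann) (a : ℝ) :
    ((H (pr (tp a))).2 : ℝ) = 1 ∨ ((H (pr (tp a))).2 : ℝ) = -1 := by
  by_contra hcon
  push Not at hcon
  set q := H (pr (tp a)) with hq
  have q1 : (q.2 : ℝ) < 1 := lt_of_le_of_ne q.2.2.2 hcon.1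
  have q2 : (-1 : ℝ) < q.2 := lt_of_le_of_ne q.2.2.1 (Ne.symm hcon.2)
  obtain ⟨qt, hqt⟩ := pr_surj q
  have hqt2 : qt.2 = q.2 := by rw [← hqt]; rfl
  have hinj : ∀ z : Strip, |z.1 - a| ≤ 1 / 2 → ea (H (pr z)) = ea q → wc a z = 0 := by
    intro z hz h
    have := H.injective (ea_inj h)
    obtain ⟨k, hk⟩ := pr_eq_pr this
    have hz1 : z.1 = a + k := by rw [hk]; rfl
    rw [hz1, add_sub_cancel_left] at hz
    have hk1 : |(k : ℝ)| < 1 := by linarith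
    have hk2 : |k| < 1 := by exact_mod_cast hk1
    rw [Int.abs_lt_one_iff] at hk2
    rw [hk, hk2]
    apply Complex.ext <;> simp [wc]
  have habs : ∀ z : Strip, |z.1 - a| ≤ ‖wc a z‖ := fun z => Complex.abs_re_le_norm (wc a z)
  -- logarithm in polar coordinates
  have hne : ∀ v, ea (H (pr (Pol a v))) - ea q ≠ 0 := by
    intro v h
    have hw := wc_Pol a v
    have hr : 0 < Real.exp (min v.1 0) / 2 := by positivity
    have hr1 : Real.exp (min v.1 0) / 2 ≤ 1 / 2 := by
      have : Real.exp (min v.1 0) ≤ 1 := Real.exp_le_one_iff.mpr (min_le_right _ _)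
      linarith
    have hnorm : ‖wc a (Pol a v)‖ = Real.exp (min v.1 0) / 2 := by
      rw [hw, norm_mul, Complex.norm_exp_ofReal_mul_I, mul_one, Complex.norm_real,
        Real.norm_of_nonneg hr.le]
    have h0 := hinj (Pol a v) ((habs _).trans (hnorm.le.trans hr1)) (sub_eq_zero.mp h)
    rw [h0, norm_zero] at hnorm
    linarith
  have hcont : Continuous fun v => ea (H (pr (Pol a v))) - ea q :=
    (continuous_ea.comp (H.continuous.comp (continuous_pr.comp (continuous_Pol a)))).sub
      continuous_const
  obtain ⟨L, hL, hLe, -⟩ := exists_log_plane _ hcont hne (0, 0) _ (Complex.exp_log (hne (0, 0)))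
  -- the half ball
  set B : Set Strip := {z | ‖wc a z‖ < 1 / 2} with hB
  have hBo : IsOpen B := isOpen_lt (continuous_wc a).norm continuous_const
  have hemb : Topology.IsOpenEmbedding (fun b : B => pr b) := by
    refine Topology.IsOpenEmbedding.of_continuous_injective_isOpenMap
      (continuous_pr.comp continuous_subtype_val) ?_
      (isOpenMap_pr.comp hBo.isOpenMap_subtype_val)
    rintro ⟨z, hz⟩ ⟨w, hw⟩ h
    obtain ⟨k, hk⟩ := pr_eq_pr h
    replace hk : z = shiftPt k w := hk
    have h1 := lt_of_le_of_lt (habs z) hz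
    have h2 := lt_of_le_of_lt (habs w) hw
    have hz1 : z.1 = w.1 + k := by rw [hk]; rfl
    rw [abs_lt] at h1 h2
    have hk1 : |(k : ℝ)| < 1 := by rw [abs_lt]; constructor <;> linarith
    have hk2 : |k| < 1 := by exact_mod_cast hk1
    rw [Int.abs_lt_one_iff] at hk2
    apply Subtype.ext
    show z = w
    rw [hk, hk2, shiftPt_zero]
  have hNo : IsOpen (H '' (range fun b : B => pr b)) := H.isOpenMap _ hemb.isOpen_range
  have hqN : q ∈ H '' (range fun b : B => pr b) := by
    refine ⟨pr (tp a), ⟨⟨tp a, ?_⟩, rfl⟩, rfl⟩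
    have : wc a (tp a) = 0 := by apply Complex.ext <;> simp [wc]
    rw [hB, mem_ofPred_eq, this]; norm_num
  -- small circles
  set Z : ℂ → Strip := fun v => cl (qt.1 + v.im / (2 * Real.pi), (qt.2 : ℝ) + v.re) with hZ
  have hZc : Continuous Z := continuous_cl.comp (by fun_prop)
  have hZ0 : Z (Complex.log (1 + 0)) = qt := by
    simp only [hZ, add_zero, Complex.log_one, Complex.zero_im, Complex.zero_re, zero_div]
    exact cl_emb qt
  have hca : ContinuousAt (fun ζ : ℂ => Complex.log (1 + ζ)) 0 :=
    ContinuousAt.clog (by fun_prop) (by simp)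
  have ev1 : ∀ᶠ ζ in 𝓝 (0 : ℂ), pr (Z (Complex.log (1 + ζ))) ∈ H '' (range fun b : B => pr b) := by
    have : ContinuousAt (fun ζ : ℂ => pr (Z (Complex.log (1 + ζ)))) 0 :=
      ContinuousAt.comp (g := fun v => pr (Z v)) (continuous_pr.comp hZc).continuousAt hca
    refine this.eventually_mem (hNo.mem_nhds ?_)
    rw [hZ0, hqt]; exact hqN
  have ev2 : ∀ᶠ ζ in 𝓝 (0 : ℂ), (qt.2 : ℝ) + (Complex.log (1 + ζ)).re ∈ Ioo (-1 : ℝ) 1 := by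
    have : ContinuousAt (fun ζ : ℂ => (qt.2 : ℝ) + (Complex.log (1 + ζ)).re) 0 :=
      continuousAt_const.add (Complex.continuous_re.continuousAt.comp hca)
    refine this.eventually_mem (isOpen_Ioo.mem_nhds ?_)
    rw [hqt2]
    simp only [add_zero, Complex.log_one, Complex.zero_re]
    exact ⟨q2, q1⟩
  obtain ⟨δ, hδ, hball⟩ := Metric.eventually_nhds_iff.mp (ev1.and ev2)
  set ε : ℝ := min δ 1 / 2 with hε
  have ε0 : 0 < ε := by have := lt_min hδ one_pos; rw [hε]; linarith
  have ε1 : ε < 1 := by have := min_le_right δ 1; rw [hε]; linarith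
  have εδ : ε < δ := by
    have h1 := min_le_left δ 1
    have := lt_min hδ one_pos
    rw [hε]; linarith
  set ζ : ℝ → ℂ := fun φ => (ε : ℂ) * Complex.exp (φ * Complex.I) with hζ
  have hζn : ∀ φ, ‖ζ φ‖ = ε := fun φ => by
    simp only [hζ]
    rw [norm_mul, Complex.norm_exp_ofReal_mul_I, mul_one, Complex.norm_real,
        Real.norm_of_nonneg ε0.le]
  have hζc : Continuous ζ := by simp only [hζ]; fun_prop
  have hζb : ∀ φ, pr (Z (Complex.log (1 + ζ φ))) ∈ H '' (range fun b : B => pr b) ∧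
      (qt.2 : ℝ) + (Complex.log (1 + ζ φ)).re ∈ Ioo (-1 : ℝ) 1 := fun φ =>
    hball (by rw [dist_zero_right, hζn]; exact εδ)
  have hslit : ∀ φ, 1 + ζ φ ∈ Complex.slitPlane := fun φ =>
    Complex.mem_slitPlane_of_norm_lt_one (by rw [hζn]; exact ε1)
  have hb : ∀ φ, ∃ b : B, H (pr b) = pr (Z (Complex.log (1 + ζ φ))) := by
    intro φ
    obtain ⟨_, ⟨b, rfl⟩, h⟩ := (hζb φ).1
    exact ⟨b, h⟩
  choose b hb using hb
  have hzc : Continuous fun φ => pr (Z (Complex.log (1 + ζ φ))) :=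
    continuous_pr.comp (hZc.comp ((continuous_const.add hζc).clog hslit))
  have hbc : Continuous b := by
    rw [hemb.isInducing.continuous_iff]
    have : ((fun b : B => pr b) ∘ b) = fun φ => H.symm (pr (Z (Complex.log (1 + ζ φ)))) := by
      funext φ
      simp only [Function.comp]
      rw [← hb, H.symm_apply_apply]
    rw [this]
    exact H.symm.continuous.comp hzc
  have hval : ∀ φ, ea (H (pr (b φ))) - ea q = ea q * ζ φ := by
    intro φ
    have hcl : ((Z (Complex.log (1 + ζ φ))).2 : ℝ) = (qt.2 : ℝ) + (Complex.log (1 + ζ φ)).re := by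
      simp only [hZ, cl]
      rw [Set.projIcc_of_mem (by norm_num) ⟨(hζb φ).2.1.le, (hζb φ).2.2.le⟩]
    have hcl1 : (Z (Complex.log (1 + ζ φ))).1 = qt.1 + (Complex.log (1 + ζ φ)).im / (2 * Real.pi) :=
      rfl
    have hexp : Complex.exp (Complex.log (1 + ζ φ)) = 1 + ζ φ :=
      Complex.exp_log (Complex.slitPlane_ne_zero (hslit φ))
    have : ea (pr (Z (Complex.log (1 + ζ φ)))) = ea q * (1 + ζ φ) := by
      have hR : ea q * (1 + ζ φ) = Complex.exp (((qt.2 : ℝ) + 2 * Real.pi * qt.1 * Complex.I) +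
          Complex.log (1 + ζ φ)) := by
        rw [Complex.exp_add, hexp, ← ea_pr, hqt]
      rw [ea_pr, hcl, hcl1, hR]
      congr 1
      generalize Complex.log (1 + ζ φ) = l
      have hl := Complex.re_add_im l
      have hp : (Real.pi : ℂ) ≠ 0 := by exact_mod_cast Real.pi_pos.ne'
      push_cast
      have h3 : 2 * (Real.pi : ℂ) * ((qt.1 : ℂ) + (l.im : ℂ) / (2 * Real.pi)) =
          2 * Real.pi * qt.1 + l.im := by field_simp
      rw [h3]
      linear_combination hl
    rw [hb, this]; ring
  have hζ0 : ∀ φ, ζ φ ≠ 0 := fun φ h => by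
    have := hζn φ; rw [h, norm_zero] at this; linarith
  have hwne : ∀ φ, wc a (b φ) ≠ 0 := by
    intro φ h
    have h2 : ((b φ : Strip)) = tp a := by
      have k1 := congrArg Complex.re h
      have k2 := congrArg Complex.im h
      simp only [wc, Complex.zero_re, Complex.zero_im] at k1 k2
      refine Prod.ext ?_ (Subtype.ext ?_)
      · simp; linarith
      · simp; linarith
    have := hval φ
    rw [h2, ← hq, sub_self] at this
    exact mul_ne_zero (ea_ne q) (hζ0 φ) this.symm
  have hwc : Continuous fun φ => wc a (b φ) :=
    (continuous_wc a).comp (continuous_subtype_val.comp hbc)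
  have hlc : Continuous fun φ => Complex.log (wc a (b φ)) :=
    continuous_log_upper _ hwc (fun φ => by
      have := (b φ : Strip).2.2.2; simp only [wc]; linarith) hwne
  set M : ℝ → ℂ := fun φ => L ((Complex.log (wc a (b φ))).re + Real.log 2,
    (Complex.log (wc a (b φ))).im) with hM
  have hMc : Continuous M := hL.comp
    (((Complex.continuous_re.comp hlc).add continuous_const).prodMk (Complex.continuous_im.comp hlc))
  have hMe : ∀ φ, Complex.exp (M φ) = ea q * ζ φ := by
    intro φ
    simp only [hM]
    rw [hLe, Pol_inv a _ (hwne φ) (b φ).2.le, hval]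
  have hεe : Complex.exp (Complex.log (ea q * ε)) = ea q * ε :=
    Complex.exp_log (mul_ne_zero (ea_ne q) (by exact_mod_cast ε0.ne'))
  have e := log_diff_const M (fun φ => Complex.log (ea q * ε) + φ * Complex.I) hMc (by fun_prop)
    (fun φ => by
      rw [hMe, Complex.exp_add, hεe]; simp only [hζ]; ring) (2 * Real.pi) 0
  have hζp : ζ (2 * Real.pi) = ζ 0 := by
    simp only [hζ]
    push_cast
    rw [Complex.exp_two_pi_mul_I]; simp
  have hbp : b (2 * Real.pi) = b 0 := by
    apply hemb.injective
    apply H.injective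
    show H (pr _) = H (pr _)
    rw [hb, hb, hζp]
  have hMp : M (2 * Real.pi) = M 0 := by simp only [hM]; rw [hbp]
  rw [hMp] at e
  push_cast at e
  have : (2 * Real.pi * Complex.I : ℂ) = 0 := by linear_combination -e
  exact Complex.two_pi_I_ne_zero this

/-- A map isotopic to the identity preserves the top circle. -/
lemma top_inv {f : Ann → Ann} (hf : IsotopicToId f) (a : ℝ) : ((f (pr (tp a))).2 : ℝ) = 1 := by
  obtain ⟨H, hc, hbij, h0, h1⟩ := hf
  have hdi : ∀ t, ((H t (pr (tp a))).2 : ℝ) = 1 ∨ ((H t (pr (tp a))).2 : ℝ) = -1 := by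
    intro t
    have hct : Continuous (H t) := hc.comp (by fun_prop : Continuous fun p : Ann => (t, p))
    have := bdry (Continuous.homeoOfEquivCompactToT2 (f := Equiv.ofBijective (H t) (hbij t)) hct) a
    exact this
  have hcont : Continuous fun t => ((H t (pr (tp a))).2 : ℝ) := by
    have : Continuous fun t : ℝ => H t (pr (tp a)) :=
      hc.comp (by fun_prop : Continuous fun t : ℝ => (t, pr (tp a)))
    fun_prop
  rw [← h1]
  rcases hdi 1 with h | h
  · exact h
  · exfalso
    have hs0 : ((H 0 (pr (tp a))).2 : ℝ) = 1 := by rw [h0]; rfl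
    obtain ⟨t, ht⟩ := mem_range_of_exists_le_of_exists_ge hcont (c := 0)
      ⟨1, by rw [h]; norm_num⟩ ⟨0, by rw [hs0]; norm_num⟩
    simp only at ht
    rcases hdi t with h' | h' <;> rw [h'] at ht <;> norm_num at ht

/-- Three path version of `meet_log`. -/
lemma meet3 {X Um Up : Set Ann} (hX : IsEAC X Um Up) {e : II} (he : Et X e)
    {γ γ' τ : unitInterval → Strip} {y : Strip} (hγ : IsArcTo (pr ⁻¹' Up) γ y)
    (hγ' : IsArcTo (pr ⁻¹' Up) γ' y) (hτ : IsArcTo (pr ⁻¹' Up) τ y)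
    (h0 : ((γ 0).2 : ℝ) = 1) (h0' : ((γ' 0).2 : ℝ) = 1) (hm : Meet γ τ) (hm' : Meet γ' τ)
    (z : Strip) (hz : pr z ∈ X) (hzy : y ≠ z) (L L' : unitInterval → ℂ) (hL : IsLg γ z L)
    (hL' : IsLg γ' z L') : L 1 = L' 1 := by
  have h01 : (0 : unitInterval) ≠ 1 := by rw [uI_ne_one]; norm_num
  have hj : ∃ a : ℝ, JoinedIn (pr ⁻¹' Up) (tp a) (τ 0) := by
    obtain ⟨j, h | h⟩ := cover_U hX he (hτ.2.2.1 0 h01)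
    · refine ⟨j + 1 / 2, ((DD_path hX he j).joinedIn _ (tp_DD hX ?_ ?_) _ h).mono
        fun z hz => DD_U hz⟩ <;> linarith
    · exact ⟨j, ((BB_path (e_lt hX he) j).joinedIn _ (tp_BB hX he j) _ h).mono
        fun z hz => BB_U hX he hz⟩
  obtain ⟨a, p, hp⟩ := hj
  let q : Path (τ 0) (τ 1) := { toFun := τ, continuous_toFun := hτ.1, source' := rfl, target' := rfl }
  have hq : ∀ t, q t = τ t := fun t => rfl
  have hc : Continuous (p.trans q) := (p.trans q).continuous
  have hU : ∀ t, t ≠ 1 → pr ((p.trans q) t) ∈ Up := by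
    intro t ht
    rw [Path.trans_apply]
    split_ifs with h
    · exact hp _
    · rw [hq]
      refine hτ.2.2.1 _ ?_
      rw [uI_ne_one] at ht ⊢
      show 2 * (t : ℝ) - 1 < 1
      linarith
  have hs : (((p.trans q) 0).2 : ℝ) = 1 := by rw [Path.source]; rfl
  have he1 : (p.trans q) 1 = y := by rw [Path.target]; exact hτ.2.2.2
  have hM : ∀ σ, Meet σ τ → Meet σ (p.trans q) := by
    intro σ h d hd
    have hd' : max (max d (2 * d - 1)) 0 < 1 := max_lt (max_lt hd (by linarith)) one_pos
    obtain ⟨s, t, h1, h2, h3, h4, h5⟩ := h _ hd'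
    have k1 := lt_of_le_of_lt ((le_max_left _ _).trans (le_max_left _ _)) h1
    have k2 := lt_of_le_of_lt ((le_max_right d _).trans (le_max_left _ _)) h2
    have k3 := lt_of_le_of_lt (le_max_right _ _) h2
    have k4 := uI_ne_one.mp h4
    refine ⟨s, ⟨((t : ℝ) + 1) / 2, by linarith, by linarith⟩, k1, ?_, h3, ?_, ?_⟩
    · show d < ((t : ℝ) + 1) / 2
      linarith
    · rw [uI_ne_one]
      show ((t : ℝ) + 1) / 2 < 1
      linarith
    · rw [Path.trans_apply, dif_neg (by show ¬ ((t : ℝ) + 1) / 2 ≤ 1 / 2; linarith), hq, h5]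
      congr 1
      apply Subtype.ext
      show (t : ℝ) = 2 * (((t : ℝ) + 1) / 2) - 1
      ring
  have hzt : ∀ t, (p.trans q) t ≠ z := by
    intro t
    by_cases ht : t = 1
    · rw [ht, he1]; exact hzy
    · exact U_ne_X hX (hU t ht) hz
  obtain ⟨M, hMl⟩ := exists_isLg _ hc z hzt
  have a1 := meet_log hX γ (p.trans q) hγ.1 hc hγ.2.2.1 hU h0 hs (by rw [he1]; exact hγ.2.2.2)
    (hM _ hm) z hz (by rw [hγ.2.2.2]; exact hzy) L M hL hMl
  have a2 := meet_log hX γ' (p.trans q) hγ'.1 hc hγ'.2.2.1 hU h0' hs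
    (by rw [he1]; exact hγ'.2.2.2) (hM _ hm') z hz (by rw [hγ'.2.2.2]; exact hzy) L' M hL' hMl
  rw [a1, a2]

/-- The circular order on access paths. -/
def AOrd (Up : Set Ann) (τ σ : unitInterval → Strip) : Prop :=
  ∃ γ δ, IsArcTo (pr ⁻¹' Up) γ (τ 1) ∧ IsArcTo (pr ⁻¹' Up) δ (σ 1) ∧ Meet γ τ ∧ Meet δ σ ∧
    ((γ 0).2 : ℝ) = 1 ∧ ((δ 0).2 : ℝ) = 1 ∧ (γ 0).1 < (δ 0).1 ∧ ∀ s t, γ s ≠ δ t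

lemma arc_ne {X Um Up : Set Ann} (hX : IsEAC X Um Up) {γ : unitInterval → Strip} {y z : Strip}
    (hγ : IsArcTo (pr ⁻¹' Up) γ y) (hz : pr z ∈ X) (hyz : y ≠ z) : ∀ t, γ t ≠ z := by
  intro t
  by_cases ht : t = 1
  · rw [ht, hγ.2.2.2]; exact hyz
  · exact U_ne_X hX (hγ.2.2.1 t ht) hz

lemma AOrd_asymm {X Um Up : Set Ann} (hX : IsEAC X Um Up) {e : II} (he : Et X e)
    {τ σ : unitInterval → Strip} {y z : Strip} (hτ : IsArcTo (pr ⁻¹' Up) τ y)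
    (hσ : IsArcTo (pr ⁻¹' Up) σ z) (hy : pr y ∈ X) (hz : pr z ∈ X) (hyz : y ≠ z)
    (h1 : AOrd Up τ σ) (h2 : AOrd Up σ τ) : False := by
  obtain ⟨γ, δ, a1, a2, a3, a4, a5, a6, a7, a8⟩ := h1
  obtain ⟨δ', γ', b1, b2, b3, b4, b5, b6, b7, b8⟩ := h2
  rw [hτ.2.2.2] at a1 b2
  rw [hσ.2.2.2] at a2 b1
  obtain ⟨L1, l1⟩ := exists_isLg γ a1.1 z (arc_ne hX a1 hz hyz)
  obtain ⟨L2, l2⟩ := exists_isLg δ a2.1 y (arc_ne hX a2 hy hyz.symm)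
  obtain ⟨M1, m1⟩ := exists_isLg γ' b2.1 z (arc_ne hX b2 hz hyz)
  obtain ⟨M2, m2⟩ := exists_isLg δ' b1.1 y (arc_ne hX b1 hy hyz.symm)
  have e1 := pair_log γ δ a1.1 a2.1 a8 a5 a6 a7 L1 L2 (by rw [a2.2.2.2]; exact l1)
    (by rw [a1.2.2.2]; exact l2)
  have e2 := pair_log δ' γ' b1.1 b2.1 b8 b5 b6 b7 M2 M1 (by rw [b2.2.2.2]; exact m2)
    (by rw [b1.2.2.2]; exact m1)
  have e3 := meet3 hX he a1 b2 hτ a5 b6 a3 b4 z hz hyz L1 M1 l1 m1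
  have e4 := meet3 hX he a2 b1 hσ a6 b5 a4 b3 y hy hyz.symm L2 M2 l2 m2
  apply Complex.two_pi_I_ne_zero
  linear_combination -e1 - e2 + e3 - e4

lemma AOrd_of_key {X Um Up : Set Ann} (hX : IsEAC X Um Up) {e : II} (he : Et X e)
    {τ σ : unitInterval → Strip} {y z : Strip} (hτ : IsArcTo (pr ⁻¹' Up) τ y)
    (hσ : IsArcTo (pr ⁻¹' Up) σ z) (hy : pr y ∈ X) (hz : pr z ∈ X) (hyz : y ≠ z)
    {κ κ' : ℤ} (hk : Key Up e τ κ) (hk' : Key Up e σ κ') (hlt : κ < κ') : AOrd Up τ σ := by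
  obtain ⟨γ, a1, a2, a3, a4⟩ := exists_rep hX he hτ hy hk
  obtain ⟨δ, b1, b2, b3, b4⟩ := exists_rep hX he hσ hz hk'
  refine ⟨γ, δ, by rw [hτ.2.2.2]; exact a1, by rw [hσ.2.2.2]; exact b1, a3, b3,
    by rw [a2]; rfl, by rw [b2]; rfl, ?_, ?_⟩
  · rw [a2, b2]
    show (κ : ℝ) / 2 < κ' / 2
    have : (κ : ℝ) < κ' := by exact_mod_cast hlt
    linarith
  · exact arcs_disj hX a1 b1 hy hz hyz (cell_disj hX he hlt.ne) a4 b4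

/-- Maps acting on access paths. -/
structure Nice (X Up : Set Ann) (G : Strip → Strip) : Prop where
  cont : Continuous G
  inj : Function.Injective G
  up : ∀ z, pr z ∈ Up → pr (G z) ∈ Up
  mx : ∀ z, pr z ∈ X → pr (G z) ∈ X

/-- Maps preserving the top order. -/
structure NiceT (X Up : Set Ann) (G : Strip → Strip) : Prop extends Nice X Up G where
  top : ∀ a, ((G (tp a)).2 : ℝ) = 1
  mono : ∀ a b, a < b → (G (tp a)).1 < (G (tp b)).1

lemma Nice.iter {X Up : Set Ann} {G : Strip → Strip} (h : Nice X Up G) (n : ℕ) :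
    Nice X Up G^[n] := by
  induction n with
  | zero => exact ⟨continuous_id, Function.injective_id, fun z h => h, fun z h => h⟩
  | succ n ih =>
    rw [Function.iterate_succ']
    exact ⟨h.cont.comp ih.cont, h.inj.comp ih.inj, fun z hz => h.up _ (ih.up z hz),
      fun z hz => h.mx _ (ih.mx z hz)⟩

lemma NiceT.iter {X Up : Set Ann} {G : Strip → Strip} (h : NiceT X Up G) (n : ℕ) :
    NiceT X Up G^[n] := by
  refine ⟨h.toNice.iter n, ?_, ?_⟩
  · induction n with
    | zero => exact fun a => rfl
    | succ n ih =>
      intro a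
      rw [Function.iterate_succ', Function.comp, eq_tp (ih a)]
      exact h.top _
  · have ht : ∀ a, ((G^[n] (tp a)).2 : ℝ) = 1 := by
      induction n with
      | zero => exact fun a => rfl
      | succ n ih =>
        intro a
        rw [Function.iterate_succ', Function.comp, eq_tp (ih a)]
        exact h.top _
    clear ht
    have key : ∀ a b, a < b → ((G^[n] (tp a)).2 : ℝ) = 1 ∧ ((G^[n] (tp b)).2 : ℝ) = 1 ∧
        (G^[n] (tp a)).1 < (G^[n] (tp b)).1 := by
      induction n with
      | zero => exact fun a b hab => ⟨rfl, rfl, hab⟩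
      | succ n ih =>
        intro a b hab
        obtain ⟨i1, i2, i3⟩ := ih a b hab
        rw [Function.iterate_succ', Function.comp, Function.comp, eq_tp i1, eq_tp i2]
        exact ⟨h.top _, h.top _, h.mono _ _ i3⟩
    exact fun a b hab => (key a b hab).2.2

lemma Nice.arc {X Up : Set Ann} {G : Strip → Strip} (h : Nice X Up G)
    {γ : unitInterval → Strip} {y : Strip} (hγ : IsArcTo (pr ⁻¹' Up) γ y) :
    IsArcTo (pr ⁻¹' Up) (G ∘ γ) (G y) :=
  ⟨h.cont.comp hγ.1, h.inj.comp hγ.2.1, fun t ht => h.up _ (hγ.2.2.1 t ht), by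
    rw [Function.comp, hγ.2.2.2]⟩

lemma Meet.map {τ σ : unitInterval → Strip} (h : Meet τ σ) (G : Strip → Strip) :
    Meet (G ∘ τ) (G ∘ σ) := by
  intro d hd
  obtain ⟨s, t, h1, h2, h3, h4, h5⟩ := h d hd
  exact ⟨s, t, h1, h2, h3, h4, congrArg G h5⟩

lemma AOrd.map {X Up : Set Ann} {G : Strip → Strip} (hG : NiceT X Up G)
    {τ σ : unitInterval → Strip} (h : AOrd Up τ σ) : AOrd Up (G ∘ τ) (G ∘ σ) := by
  obtain ⟨γ, δ, a1, a2, a3, a4, a5, a6, a7, a8⟩ := h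
  refine ⟨G ∘ γ, G ∘ δ, hG.arc a1, hG.arc a2, a3.map G, a4.map G, ?_, ?_, ?_, ?_⟩
  · rw [Function.comp, eq_tp a5]; exact hG.top _
  · rw [Function.comp, eq_tp a6]; exact hG.top _
  · rw [Function.comp, Function.comp, eq_tp a5, eq_tp a6]; exact hG.mono _ _ a7
  · exact fun s t h => a8 s t (hG.inj h)

lemma no_lower (k : ℕ → ℤ) (ρ : ℝ) (hρ : ρ < 0)
    (h : Tendsto (fun n : ℕ => (k n : ℝ) / (n : ℝ)) atTop (𝓝 ρ)) (N : ℕ) (hN : 1 ≤ N) (C : ℤ)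
    (hC : ∀ m, C ≤ k (N * m)) : False := by
  have ev := h.eventually (gt_mem_nhds (show ρ < ρ / 2 by linarith))
  obtain ⟨n₀, hn₀⟩ := eventually_atTop.mp ev
  obtain ⟨m₁, hm₁⟩ := exists_nat_gt (C / (ρ / 2))
  set m := max (max n₀ m₁) 1 with hm
  have hm0 : n₀ ≤ m := (le_max_left _ _).trans (le_max_left _ _)
  have hm1 : m₁ ≤ m := (le_max_right n₀ _).trans (le_max_left _ _)
  have hm2 : 1 ≤ m := le_max_right _ _
  have hNm : m ≤ N * m := Nat.le_mul_of_pos_left m hN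
  have h1 := hn₀ (N * m) (hm0.trans hNm)
  have hpos : (0 : ℝ) < (N * m : ℕ) := by exact_mod_cast lt_of_lt_of_le hm2 hNm
  rw [div_lt_iff₀ hpos] at h1
  have h2 : (C : ℝ) ≤ k (N * m) := by exact_mod_cast hC m
  have h3 : (m₁ : ℝ) ≤ (N * m : ℕ) := by exact_mod_cast hm1.trans hNm
  rw [div_lt_iff_of_neg (by linarith)] at hm₁
  nlinarith

lemma main_key {X Um Up : Set Ann} (hX : IsEAC X Um Up) {e : II} (he : Et X e)
    {F : Strip → Strip} (hF : NiceT X Up F) {ρ : ℝ} (hρ : ρ < 0)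
    (hrot : PrimeEndRotB 1 (pr ⁻¹' Up) (pr ⁻¹' X) F ρ) {τ : unitInterval → Strip} {y : Strip}
    (hτ : IsArcTo (pr ⁻¹' Up) τ y) (hy : pr y ∈ X) (N : ℕ) (hN : 1 ≤ N) {κ κ' : ℤ}
    (hk : Key Up e τ κ) (hk' : Key Up e (F^[N] ∘ τ) κ') : κ' ≤ κ := by
  by_contra hlt
  push Not at hlt
  have harc : ∀ n, IsArcTo (pr ⁻¹' Up) (F^[n] ∘ τ) (F^[n] y) := fun n => (hF.iter n).arc hτ
  have hyX : ∀ n, pr (F^[n] y) ∈ X := fun n => (hF.iter n).mx _ hy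
  have hex : ∀ n, ∃ κ, Key Up e (F^[n] ∘ τ) κ := fun n =>
    exists_key hX he (harc n).1 (harc n).2.2.1 (by rw [(harc n).2.2.2]; exact hyX n)
  choose K hK using hex
  have hacc0 : AccFrom (pr ⁻¹' Up) ((0 : ℝ), e) := ⟨bt e 0, by simpa using bt_arc hX he 0⟩
  have hidx : ∀ n, ∃ k : ℤ, K n ≤ 2 * k + 1 ∧ AccIdxB 1 (pr ⁻¹' Up) (F^[n] y) ((0 : ℝ), e) k :=
    fun n => exists_idx hX he (harc n) (hyX n) (hK n)
  choose k hk1 hk2 using hidx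
  have hr := hrot y hy ((0 : ℝ), e) he.1 ⟨τ, hτ⟩ hacc0
  by_cases hfix : F^[N] y = y
  · have hper : ∀ m, F^[N * m] y = y := by
      intro m
      rw [Function.iterate_mul]
      exact Function.iterate_fixed hfix m
    refine no_lower (fun n => if F^[n] y = y then k 0 else k n) ρ hρ (hr _ ?_) N hN (k 0) ?_
    · intro n
      by_cases h : F^[n] y = y
      · simp only [h, if_true]; exact hk2 0
      · simp only [h, if_false]; exact hk2 n
    · intro m
      simp only [hper m, if_true]; exact le_rfl
  · have h0 : AOrd Up τ (F^[N] ∘ τ) := AOrd_of_key hX he hτ (harc N) hy (hyX N) (Ne.symm hfix) hk hk' hlt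
    have hm : ∀ m, K (N * m) ≤ K (N * (m + 1)) := by
      intro m
      by_contra hcon
      push Not at hcon
      have hne : F^[N * m] y ≠ F^[N * (m + 1)] y := by
        intro h
        rw [Nat.mul_succ, Function.iterate_add_apply] at h
        exact hfix ((hF.iter _).inj h).symm
      have o1 : AOrd Up (F^[N * m] ∘ τ) (F^[N * (m + 1)] ∘ τ) := by
        have := h0.map (hF.iter (N * m))
        rw [← Function.comp_assoc, ← Function.iterate_add] at this
        exact this
      exact AOrd_asymm hX he (harc _) (harc _) (hyX _) (hyX _) hne o1
        (AOrd_of_key hX he (harc _) (harc _) (hyX _) (hyX _) hne.symm (hK _) (hK _) hcon)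
    have hm' : ∀ m, K 0 ≤ K (N * m) := by
      intro m
      induction m with
      | zero => simp
      | succ m ih => exact ih.trans (hm m)
    refine no_lower k ρ hρ (hr k hk2) N hN ((K 0 - 1) / 2) ?_
    intro m
    have a1 := hm' m
    have a2 := hk1 (N * m)
    omega

lemma f_Up {X Um Up : Set Ann} (hX : IsEAC X Um Up) (f : Ann → Ann) (hc : Continuous f)
    (hXc : ∀ p, f p ∈ X → p ∈ X) (p : Ann) (hp : p ∈ Up) (hfp : f p ∈ Up) :
    ∀ q ∈ Up, f q ∈ Up := by
  have hconn : IsPreconnected Up := by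
    rw [hX.hUp]; exact isPreconnected_connectedComponentIn
  have him : IsPreconnected (f '' Up) := hconn.image f hc.continuousOn
  have hsub : f '' Up ⊆ Xᶜ := by
    rintro _ ⟨q, hq, rfl⟩ h
    exact Up_sub hX hq (hXc q h)
  intro q hq
  have h1 := him.subset_connectedComponentIn ⟨p, hp, rfl⟩ hsub ⟨q, hq, rfl⟩
  rw [hX.hUp] at hfp
  rw [← connectedComponentIn_eq hfp, ← hX.hUp] at h1
  exact h1

lemma F_nice {X Um Up : Set Ann} (hX : IsEAC X Um Up) (f : Ann ≃ₜ Ann) (hf : IsotopicToId ⇑f)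
    (F : Strip ≃ₜ Strip) (hF : IsLift ⇑f ⇑F) (hinv : ⇑f '' X = X) :
    NiceT X Up F ∧ Nice X Up F.symm := by
  have hX1 : ∀ p, p ∈ X → f p ∈ X := fun p hp => hinv ▸ mem_image_of_mem f hp
  have hX2 : ∀ p, f p ∈ X → p ∈ X := by
    intro p hp
    rw [← hinv] at hp
    obtain ⟨q, hq, h⟩ := hp
    rwa [← f.injective h]
  have htop : ∀ a, ((F (tp a)).2 : ℝ) = 1 := by
    intro a
    have h := top_inv hf a
    rw [← hF.1] at h
    exact h
  have hftop : f (pr (tp 0)) ∈ Up := by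
    rw [← hF.1, eq_tp (htop 0)]; exact tp_mem hX _
  have hU1 : ∀ p ∈ Up, f p ∈ Up := f_Up hX f f.continuous hX2 (pr (tp 0)) (tp_mem hX 0) hftop
  have hU2 : ∀ p ∈ Up, f.symm p ∈ Up := by
    refine f_Up hX f.symm f.symm.continuous (fun p hp => ?_) (f (pr (tp 0))) hftop ?_
    · have := hX1 _ hp
      rwa [f.apply_symm_apply] at this
    · rw [f.symm_apply_apply]; exact tp_mem hX 0
  have hsymm : ∀ z, pr (F.symm z) = f.symm (pr z) := by
    intro z
    rw [f.eq_symm_apply, ← hF.1, F.apply_symm_apply]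
  have hcu : Continuous fun a : ℝ => (F (tp a)).1 :=
    continuous_fst.comp (F.continuous.comp continuous_tp)
  have hiu : Function.Injective fun a : ℝ => (F (tp a)).1 := by
    intro a b h
    have h2 : F (tp a) = F (tp b) := by
      rw [eq_tp (htop a), eq_tp (htop b)]; exact congrArg tp h
    exact congrArg Prod.fst (F.injective h2)
  have hmono : StrictMono fun a : ℝ => (F (tp a)).1 := by
    rcases hcu.strictMono_of_inj hiu with h | h
    · exact h
    · exfalso
      have h1 := h (show (0 : ℝ) < 1 by norm_num)
      have h2 : (F (tp 1)).1 = (F (tp 0)).1 + 1 := by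
        have : tp 1 = shiftPt 1 (tp 0) := by simp [tp, shiftPt]
        rw [this, hF.2]; simp [shiftPt]
      simp only at h1
      linarith
  refine ⟨⟨⟨F.continuous, F.injective, ?_, ?_⟩, htop, fun a b hab => hmono hab⟩,
    ⟨F.symm.continuous, F.symm.injective, ?_, ?_⟩⟩
  · intro z hz; rw [hF.1]; exact hU1 _ hz
  · intro z hz; rw [hF.1]; exact hX1 _ hz
  · intro z hz; rw [hsymm]; exact hU2 _ hz
  · intro z hz; rw [hsymm]; apply hX2; rwa [f.apply_symm_apply]

/-- The key of an access path in `V + k`. -/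
lemma key_V {X Um Up : Set Ann} (hX : IsEAC X Um Up) {e : II} (he : Et X e)
    {τ : unitInterval → Strip} {y : Strip} {k κ : ℤ}
    (hτ : IsArcTo (shiftSet k (Vset (pr ⁻¹' Up) e)) τ y) (hκ : Key Up e τ κ) :
    2 * k ≤ κ ∧ κ ≤ 2 * k + 2 := by
  rcases hκ with ⟨j, rfl, s, hs, h⟩ | ⟨j, rfl, -, h⟩
  · have := (V_cases hX he (hτ.2.2.1 s hs)).1 (h s le_rfl hs)
    omega
  · obtain ⟨t, -, ht, hB⟩ := h 0 one_pos
    rcases (V_cases hX he (hτ.2.2.1 t ht)).2 hB with h | h <;> omega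

lemma acc_minus {X Um Up : Set Ann} (hX : IsEAC X Um Up) {e : II} (he : Et X e)
    {τ : unitInterval → Strip} {y : Strip} {k κ : ℤ} (hτ : IsArcTo (pr ⁻¹' Up) τ y)
    (hκ : Key Up e τ κ) (hle : κ ≤ 2 * k + 2) : AccFrom (VMinus k (Vset (pr ⁻¹' Up) e)) y := by
  rcases hκ with ⟨j, rfl, s, hs, h⟩ | ⟨j, rfl, h1, -⟩
  · refine ⟨tail τ s, tail_arc hτ s hs fun t hst ht => ?_⟩
    exact mem_biUnion (show j ∈ Iic k from by simp only [mem_Iic]; omega) (DD_V (h t hst ht))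
  · rw [hτ.2.2.2] at h1
    subst h1
    have hb := bt_arc hX he j
    refine ⟨bt e j, hb.1, hb.2.1, fun t ht => ?_, hb.2.2.2⟩
    have hB := bt_mem (e_lt hX he) j t ht
    exact mem_biUnion (show j - 1 ∈ Iic k from by simp only [mem_Iic]; omega)
      (V_mem.mpr ⟨BB_U hX he hB, (BB_closure hX he hB).2⟩)

lemma acc_plus {X Um Up : Set Ann} (hX : IsEAC X Um Up) {e : II} (he : Et X e)
    {τ : unitInterval → Strip} {y : Strip} {k κ : ℤ} (hτ : IsArcTo (pr ⁻¹' Up) τ y)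
    (hκ : Key Up e τ κ) (hle : 2 * k ≤ κ) : AccFrom (VPlus k (Vset (pr ⁻¹' Up) e)) y := by
  rcases hκ with ⟨j, rfl, s, hs, h⟩ | ⟨j, rfl, h1, -⟩
  · refine ⟨tail τ s, tail_arc hτ s hs fun t hst ht => ?_⟩
    exact mem_biUnion (show j ∈ Ici k from by simp only [mem_Ici]; omega) (DD_V (h t hst ht))
  · rw [hτ.2.2.2] at h1
    subst h1
    have hb := bt_arc hX he j
    refine ⟨bt e j, hb.1, hb.2.1, fun t ht => ?_, hb.2.2.2⟩
    have hB := bt_mem (e_lt hX he) j t ht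
    exact mem_biUnion (show j ∈ Ici k from by simp only [mem_Ici]; omega)
      (V_mem.mpr ⟨BB_U hX he hB, (BB_closure hX he hB).1⟩)

lemma iterZ_nat (F : Strip ≃ₜ Strip) (n : ℕ) (z : Strip) : iterZ F n z = F^[n] z := by
  unfold iterZ
  rw [zpow_natCast]
  exact congrFun (Equiv.Perm.iterate_eq_pow F.toEquiv n).symm z

lemma iterZ_neg (F : Strip ≃ₜ Strip) (n : ℕ) (z : Strip) : iterZ F (-n) z = F.symm^[n] z := by
  unfold iterZ
  rw [zpow_neg, ← inv_zpow, zpow_natCast]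
  exact congrFun (Equiv.Perm.iterate_eq_pow (F.toEquiv)⁻¹ n).symm z

/-- Lemma on prime ends, item 2: if `x` is accessible from `V + k` then
backward iterates are accessible from `(V+k)⁺` and forward iterates from `(V+k)⁻`. -/
theorem iterates_accessible
    (f : Ann ≃ₜ Ann) (hf : IsotopicToId ⇑f)
    (F : Strip ≃ₜ Strip) (hF : IsLift ⇑f ⇑F)
    (X Um Up : Set Ann) (hX : IsEAC X Um Up) (hinv : ⇑f '' X = X)
    (φ : Ann → ℝ) (hφc : Continuous φ)
    (hφ : ∀ z : Strip, φ (pr z) = (F z).1 - z.1)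
    (ρ : ℝ) (hρneg : ρ < 0)
    (hrot : PrimeEndRotB 1 (pr ⁻¹' Up) (pr ⁻¹' X) ⇑F ρ)
    (hpos : 0 < sInf (rotMes ⇑f φ X))
    (η : ℝ) (hη : etaSpec (pr ⁻¹' X) η)
    (k : ℤ) (x : Strip) (hx : x ∈ pr ⁻¹' X)
    (hacc : AccFrom (shiftSet k (Vset (pr ⁻¹' Up) η)) x) :
    ∀ n : ℤ,
      (n ≤ 0 → AccFrom (VPlus k (Vset (pr ⁻¹' Up) η)) (iterZ F n x)) ∧
      (0 ≤ n → AccFrom (VMinus k (Vset (pr ⁻¹' Up) η)) (iterZ F n x)) := by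
  obtain ⟨e, rfl, he⟩ : ∃ e : II, (e : ℝ) = η ∧ Et X e := by
    obtain ⟨⟨⟨a, e⟩, hz, hz1, hz2⟩, hub⟩ := hη
    simp only at hz1 hz2
    subst hz1
    refine ⟨e, hz2, hz, fun w hw hw1 => ?_⟩
    have := hub ⟨w, hw, hw1, rfl⟩
    rw [← hz2] at this
    exact this
  obtain ⟨hT, hS⟩ := F_nice hX f hf F hF hinv
  obtain ⟨α, hα⟩ := hacc
  have hαU : IsArcTo (pr ⁻¹' Up) α x :=
    ⟨hα.1, hα.2.1, fun t ht => (V_mem.mp (hα.2.2.1 t ht)).1, hα.2.2.2⟩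
  obtain ⟨κ, hκ⟩ := exists_key hX he hαU.1 hαU.2.2.1 (by rw [hαU.2.2.2]; exact hx)
  have hκV := key_V hX he hα hκ
  intro n
  constructor
  · intro hn
    obtain ⟨N, hN⟩ := Int.eq_ofNat_of_zero_le (a := -n) (by omega)
    have hn' : n = -(N : ℤ) := by omega
    rw [hn', iterZ_neg]
    have harc := (hS.iter N).arc hαU
    have hyX := (hS.iter N).mx x hx
    obtain ⟨κ', hκ'⟩ := exists_key hX he harc.1 harc.2.2.1 (by rw [harc.2.2.2]; exact hyX)
    refine acc_plus hX he harc hκ' ?_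
    rcases Nat.eq_zero_or_pos N with h0 | h0
    · subst h0
      exact (key_V hX he hα hκ').1
    · have hcomp : F^[N] ∘ (F.symm^[N] ∘ α) = α := by
        rw [← Function.comp_assoc]
        have : F^[N] ∘ F.symm^[N] = id := by
          funext z
          exact (Function.RightInverse.iterate F.apply_symm_apply N) z
        rw [this, Function.id_comp]
      have := main_key hX he hT hρneg hrot harc hyX N h0 hκ' (by rw [hcomp]; exact hκ)
      omega
  · intro hn
    obtain ⟨N, rfl⟩ := Int.eq_ofNat_of_zero_le hn
    rw [iterZ_nat]
    have harc := (hT.iter N).arc hαU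
    have hyX := (hT.iter N).mx x hx
    obtain ⟨κ', hκ'⟩ := exists_key hX he harc.1 harc.2.2.1 (by rw [harc.2.2.2]; exact hyX)
    refine acc_minus hX he harc hκ' ?_
    rcases Nat.eq_zero_or_pos N with h0 | h0
    · subst h0
      exact (key_V hX he hα hκ').2
    · have := main_key hX he hT hρneg hrot hαU hx N h0 hκ hκ'
      omega
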